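/- Let Ω ⊂ ℝ² be a bounded strictly convex open set with smooth boundary of strictly positive curvature. Let f : ℝ → ℝ be real analytic and nondecreasing, and let u be a positive solution of the Dirichlet problem div(∇u/√(1+|∇u|²)) = f(u) in Ω, u = 0 on ∂Ω, real analytic in Ω and C² up to the closure of Ω. Let K = {x ∈ Ω : ∇u(x) = 0} and define, for x in (closure Ω) \ K, the vector field X(x) = |∇u(x)|⁻² D²u(x)·(−∂₂u(x), ∂₁u(x)). Then there is a constant C > 0 such that |X(x)| ≥ C/|∇u(x)| for all x ∈ (closure Ω) \ K; in particular X is nonvanishing on (closure Ω) \ K. -/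

import Mathlib

open Set Metric

noncomputable section

/-- The coefficients `a_{ij}(p) = (1+|p|²)^{-1/2}(δ_{ij} − pᵢpⱼ/(1+|p|²))`
of the mean curvature operator. -/
def mcCoeff {n : ℕ} (p : EuclideanSpace ℝ (Fin n)) (i j : Fin n) : ℝ :=
  (Real.sqrt (1 + ‖p‖ ^ 2))⁻¹ * ((if i = j then 1 else 0) - p i * p j / (1 + ‖p‖ ^ 2))

/-- Second partial derivative `∂²u/∂xᵢ∂xⱼ`. -/
def hessEntry {n : ℕ} (u : EuclideanSpace ℝ (Fin n) → ℝ) (x : EuclideanSpace ℝ (Fin n))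
    (i j : Fin n) : ℝ :=
  iteratedFDeriv ℝ 2 u x ![EuclideanSpace.single i 1, EuclideanSpace.single j 1]

/-- The Hessian matrix `D²u(x)`. -/
def hessMatrix {n : ℕ} (u : EuclideanSpace ℝ (Fin n) → ℝ) (x : EuclideanSpace ℝ (Fin n)) :
    Matrix (Fin n) (Fin n) ℝ :=
  Matrix.of fun i j => hessEntry u x i j

/-- The mean curvature operator `L u = div(∇u/√(1+|∇u|²)) = Σ a_{ij}(∇u) ∂²u/∂xᵢ∂xⱼ`. -/
def meanCurv {n : ℕ} (u : EuclideanSpace ℝ (Fin n) → ℝ) (x : EuclideanSpace ℝ (Fin n)) : ℝ :=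
  ∑ i, ∑ j, mcCoeff (gradient u x) i j * hessEntry u x i j

/-- A solution of the Dirichlet problem `L u = f(u)` in `Ω`, `u = 0` on `∂Ω`:
`u ∈ C²(Ω) ∩ C(closure Ω)`. -/
def IsMCSolution {n : ℕ} (Ω : Set (EuclideanSpace ℝ (Fin n))) (f : ℝ → ℝ)
    (u : EuclideanSpace ℝ (Fin n) → ℝ) : Prop :=
  ContDiffOn ℝ 2 u Ω ∧ ContinuousOn u (closure Ω) ∧
    (∀ x ∈ Ω, meanCurv u x = f (u x)) ∧ (∀ x ∈ frontier Ω, u x = 0)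

/-- `Ω ⊆ ℝ²` has smooth boundary of strictly positive curvature: the boundary is
parametrized by a smooth periodic regular curve with positive signed curvature. -/
def SmoothPosCurvBoundary (Ω : Set (EuclideanSpace ℝ (Fin 2))) : Prop :=
  ∃ T > (0:ℝ), ∃ γ : ℝ → EuclideanSpace ℝ (Fin 2),
    ContDiff ℝ (⊤ : ℕ∞) γ ∧ Function.Periodic γ T ∧ range γ = frontier Ω ∧
    ∀ t : ℝ, deriv γ t ≠ 0 ∧
      0 < deriv γ t 0 * deriv (deriv γ) t 1 - deriv γ t 1 * deriv (deriv γ) t 0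

/-- The vector field `X(x) = |∇u(x)|⁻² D²u(x)·(−∂₂u(x), ∂₁u(x))`. -/
def Xfield (u : EuclideanSpace ℝ (Fin 2) → ℝ) (x : EuclideanSpace ℝ (Fin 2)) :
    EuclideanSpace ℝ (Fin 2) :=
  (‖gradient u x‖ ^ 2)⁻¹ •
    ((WithLp.equiv 2 (Fin 2 → ℝ)).symm
      ((hessMatrix u x).mulVec ![-(gradient u x 1), gradient u x 0]))

/-- A continuous logarithm along a segment turning counterclockwise has increasing argument. -/
theorem im_log_lt_of_segment {a b : ℂ} (hab : 0 < (starRingEnd ℂ a * b).im) {l : ℝ → ℂ}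
    (hl : ContinuousOn l (Icc 0 1))
    (hexp : ∀ t ∈ Icc (0:ℝ) 1, Complex.exp (l t) = (1 - t) * a + t * b) :
    (l 0).im < (l 1).im := by
  have ha0 : Complex.exp (l 0) = a := by simpa using hexp 0 (by simp)
  have key : ∀ t ∈ Ioc (0:ℝ) 1, 0 < Real.sin ((l t).im - (l 0).im) := by
    intro t ht
    have h1 : starRingEnd ℂ (Complex.exp (l 0)) * Complex.exp (l t)
        = starRingEnd ℂ a * ((1 - t) * a + t * b) := by
      rw [ha0, hexp t ⟨ht.1.le, ht.2⟩]
    have h2 := congrArg Complex.im h1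
    have h3 : (starRingEnd ℂ a * ((1 - t) * a + t * b)).im = t * (starRingEnd ℂ a * b).im := by
      simp; ring
    rw [h3] at h2
    have h4 : (starRingEnd ℂ (Complex.exp (l 0)) * Complex.exp (l t)).im
        = Real.exp (l 0).re * Real.exp (l t).re * Real.sin ((l t).im - (l 0).im) := by
      simp [Complex.exp_re, Complex.exp_im, Real.sin_sub]; ring
    rw [h4] at h2
    have h5 : 0 < t * (starRingEnd ℂ a * b).im := mul_pos ht.1 hab
    rw [← h2] at h5
    exact (pos_iff_pos_of_mul_pos h5).1 (by positivity)
  by_contra! hle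
  have h1 := key 1 (by simp)
  have hlt : (l 1).im - (l 0).im < 0 := by
    rcases hle.lt_or_eq with h | h
    · linarith
    · rw [h] at h1; simp at h1
  have hc : ContinuousOn (fun t => (l t).im - (l 0).im) (Icc 0 1) :=
    (Complex.continuous_im.comp_continuousOn hl).sub continuousOn_const
  have hivt := intermediate_value_Icc' (zero_le_one' ℝ) hc
  set c := max ((l 1).im - (l 0).im) (-1)
  have hc0 : c < 0 := max_lt hlt (by norm_num)
  obtain ⟨t, ht, htc⟩ := hivt (show c ∈ Icc _ _ from ⟨le_max_left _ _, by simpa using hc0.le⟩)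
  have ht0 : t ≠ 0 := by
    rintro rfl
    simp only [sub_self] at htc; linarith
  have := key t ⟨lt_of_le_of_ne ht.1 (Ne.symm ht0), ht.2⟩
  simp only at htc
  rw [htc] at this
  have h3 : Real.sin c < 0 := Real.sin_neg_of_neg_of_neg_pi_lt hc0
    (by have := Real.pi_gt_three; have : -1 ≤ c := le_max_right _ _; linarith)
  linarith

theorem eq_of_cos_sub_eq_one {g h : ℝ → ℝ} (hg : ContinuousOn g (Icc 0 1))
    (hh : ContinuousOn h (Icc 0 1)) (hcos : ∀ t ∈ Icc (0:ℝ) 1, Real.cos (g t - h t) = 1) :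
    g 0 - h 0 = g 1 - h 1 := by
  have hpre := (isPreconnected_Icc (a := (0:ℝ)) (b := 1)).image _ (hg.sub hh)
  have hall : ∀ x ∈ (fun t => g t - h t) '' Icc (0:ℝ) 1, Real.cos x = 1 := by
    rintro _ ⟨t, ht, rfl⟩; exact hcos t ht
  have main : ∀ x ∈ (fun t => g t - h t) '' Icc (0:ℝ) 1,
      ∀ y ∈ (fun t => g t - h t) '' Icc (0:ℝ) 1, ¬ x < y := by
    intro x hx y hy hxy
    have hm : min y (x + 1) ∈ (fun t => g t - h t) '' Icc (0:ℝ) 1 :=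
      hpre.Icc_subset hx hy ⟨le_min hxy.le (by linarith), min_le_left _ _⟩
    have h1 := hall _ hx
    have h2 := hall _ hm
    have hs : Real.sin x = 0 := by nlinarith [Real.sin_sq_add_cos_sq x]
    have h3 : Real.cos (min y (x + 1) - x) = 1 := by rw [Real.cos_sub, h1, h2, hs]; ring
    have hpi := Real.pi_gt_three
    have hlo : 0 < min y (x + 1) - x := sub_pos.2 (lt_min hxy (by linarith))
    have hhi : min y (x + 1) ≤ x + 1 := min_le_right _ _
    rw [Real.cos_eq_one_iff_of_lt_of_lt (by linarith) (by linarith)] at h3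
    linarith
  have m0 : g 0 - h 0 ∈ (fun t => g t - h t) '' Icc (0:ℝ) 1 := ⟨0, by simp, rfl⟩
  have m1 : g 1 - h 1 ∈ (fun t => g t - h t) '' Icc (0:ℝ) 1 := ⟨1, by simp, rfl⟩
  exact le_antisymm (not_lt.1 (main _ m1 _ m0)) (not_lt.1 (main _ m0 _ m1))

theorem cos_im_sub_eq_one {z w : ℂ} (h : Complex.exp z = Complex.exp w) :
    Real.cos (z.im - w.im) = 1 := by
  obtain ⟨n, hn⟩ := Complex.exp_eq_exp_iff_exists_int.1 h
  have : z.im - w.im = n * (2 * Real.pi) := by rw [hn]; simp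
  rw [this]; exact Real.cos_int_mul_two_pi n

/-- The tent function that is `1` on `[0,1]` and vanishes outside `(-1,2)`. -/
noncomputable def tent (s : ℝ) : ℝ := max 0 (min 1 (min (1 + s) (2 - s)))

theorem continuous_tent : Continuous tent := by unfold tent; fun_prop

theorem tent_mem (s : ℝ) : tent s ∈ Icc (0:ℝ) 1 :=
  ⟨le_max_left _ _, max_le zero_le_one (min_le_left _ _)⟩

theorem tent_of_mem {s : ℝ} (hs : s ∈ Icc (0:ℝ) 1) : tent s = 1 := by
  unfold tent
  rw [min_eq_left (le_min (by linarith [hs.1]) (by linarith [hs.2]))]; simp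

theorem tent_of_neg {s : ℝ} (h : -1 ≤ s) (h' : s ≤ 0) : tent s = 1 + s := by
  unfold tent
  rw [min_eq_left (by linarith : 1 + s ≤ 2 - s), min_eq_right (by linarith),
    max_eq_right (by linarith)]

theorem tent_of_one_le {s : ℝ} (h : 1 ≤ s) (h' : s ≤ 2) : tent s = 2 - s := by
  unfold tent
  rw [min_eq_right (by linarith : 2 - s ≤ 1 + s), min_eq_right (by linarith),
    max_eq_right (by linarith)]

theorem le_abs_of_tent_eq_zero {s : ℝ} (h : tent s = 0) : 3 / 2 ≤ |s - 1 / 2| := by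
  unfold tent at h
  have h1 : min 1 (min (1 + s) (2 - s)) ≤ 0 := max_eq_left_iff.1 h
  rcases min_le_iff.1 h1 with h | h
  · linarith
  · rcases min_le_iff.1 h with h | h
    · rw [abs_of_nonpos] <;> linarith
    · rw [abs_of_nonneg] <;> linarith

/-- A path from `a` to `b` extended to the line by the segments to the origin. -/
noncomputable def coneLoop {a b : ℂ} (γ : Path a b) (s : ℝ) : ℂ := tent s * γ.extend s

theorem continuous_coneLoop {a b : ℂ} (γ : Path a b) : Continuous (coneLoop γ) :=
  (Complex.continuous_ofReal.comp continuous_tent).mul γ.continuous_extend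

theorem coneLoop_of_neg {a b : ℂ} (γ : Path a b) {s : ℝ} (h : -1 ≤ s) (h' : s ≤ 0) :
    coneLoop γ s = (1 + s) * a := by
  rw [coneLoop, tent_of_neg h h', γ.extend_of_le_zero h']; simp

theorem coneLoop_of_one_le {a b : ℂ} (γ : Path a b) {s : ℝ} (h : 1 ≤ s) (h' : s ≤ 2) :
    coneLoop γ s = (2 - s) * b := by
  rw [coneLoop, tent_of_one_le h h', γ.extend_of_one_le h]; simp

theorem coneLoop_mem {a b : ℂ} (γ : Path a b) {S : Set ℂ} (hγ : ∀ t, γ t ∈ S)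
    (ha : ∀ t ∈ Ioc (0:ℝ) 1, (t:ℂ) * a ∈ S) (hb : ∀ t ∈ Ioc (0:ℝ) 1, (t:ℂ) * b ∈ S) {s : ℝ}
    (hs : tent s ≠ 0) : coneLoop γ s ∈ S := by
  have hpos : tent s ∈ Ioc (0:ℝ) 1 :=
    ⟨lt_of_le_of_ne (tent_mem s).1 (Ne.symm hs), (tent_mem s).2⟩
  rcases le_total s 0 with h | h
  · rw [coneLoop, γ.extend_of_le_zero h]; exact ha _ hpos
  rcases le_total s 1 with h' | h'
  · rw [coneLoop, tent_of_mem ⟨h, h'⟩, γ.extend_apply ⟨h, h'⟩]; simpa using hγ _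
  · rw [coneLoop, γ.extend_of_one_le h']; exact hb _ hpos

/-- Two disjoint sets cannot both connect the opposite members of a cyclically ordered
quadruple of segments issuing from the origin. -/
theorem false_of_joined_alternating {A B : Set ℂ} (hAB : Disjoint A B)
    (hA0 : (0:ℂ) ∉ A) (hB0 : (0:ℂ) ∉ B) {e₁ e₂ e₃ e₄ : ℂ}
    (h1 : ∀ t ∈ Ioc (0:ℝ) 1, (t:ℂ) * e₁ ∈ A) (h2 : ∀ t ∈ Ioc (0:ℝ) 1, (t:ℂ) * e₂ ∈ B)
    (h3 : ∀ t ∈ Ioc (0:ℝ) 1, (t:ℂ) * e₃ ∈ A) (h4 : ∀ t ∈ Ioc (0:ℝ) 1, (t:ℂ) * e₄ ∈ B)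
    (hA : JoinedIn A e₁ e₃) (hB : JoinedIn B e₂ e₄)
    (h12 : 0 < (starRingEnd ℂ e₁ * e₂).im) (h23 : 0 < (starRingEnd ℂ e₂ * e₃).im)
    (h34 : 0 < (starRingEnd ℂ e₃ * e₄).im) (h41 : 0 < (starRingEnd ℂ e₄ * e₁).im) : False := by
  obtain ⟨P, hP⟩ := hA
  obtain ⟨Q, hQ⟩ := hB
  set F : ℝ × ℝ → ℂ := fun x => coneLoop P x.1 - coneLoop Q x.2 with hF
  have hFc : Continuous F :=
    ((continuous_coneLoop P).comp continuous_fst).sub ((continuous_coneLoop Q).comp continuous_snd)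
  set U : Set (ℝ × ℝ) := {x | |x.1 - 1 / 2| + |x.2 - 1 / 2| < 5 / 2} with hU
  have hUo : IsOpen U := isOpen_lt (by fun_prop) continuous_const
  have hUconv : Convex ℝ U := by
    intro x hx y hy a b ha hb hab
    simp only [hU, mem_ofPred_eq] at hx hy ⊢
    have e1 : (a • x + b • y).1 - 1 / 2 = a * (x.1 - 1 / 2) + b * (y.1 - 1 / 2) := by
      simp only [Prod.fst_add, Prod.smul_fst, smul_eq_mul]; linear_combination (1 / 2) * hab
    have e2 : (a • x + b • y).2 - 1 / 2 = a * (x.2 - 1 / 2) + b * (y.2 - 1 / 2) := by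
      simp only [Prod.snd_add, Prod.smul_snd, smul_eq_mul]; linear_combination (1 / 2) * hab
    rw [e1, e2]
    have t1 := abs_add_le (a * (x.1 - 1 / 2)) (b * (y.1 - 1 / 2))
    have t2 := abs_add_le (a * (x.2 - 1 / 2)) (b * (y.2 - 1 / 2))
    simp only [abs_mul, abs_of_nonneg ha, abs_of_nonneg hb] at t1 t2
    rcases ha.eq_or_lt with h | h
    · subst h; have : b = 1 := by linarith
      subst this; linarith
    · nlinarith
  have hUsc : IsSimplyConnected U := by
    have hne : U.Nonempty := ⟨(1 / 2, 1 / 2), by simp [hU]⟩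
    have : ContractibleSpace U := hUconv.contractibleSpace hne
    exact (inferInstance : SimplyConnectedSpace U)
  have h0 : (0:ℂ) ∉ F '' U := by
    rintro ⟨x, hx, hx0⟩
    have hPQ : coneLoop P x.1 = coneLoop Q x.2 := sub_eq_zero.1 hx0
    by_cases hs : tent x.1 = 0
    · by_cases ht : tent x.2 = 0
      · have := le_abs_of_tent_eq_zero hs
        have := le_abs_of_tent_eq_zero ht
        simp only [hU, mem_ofPred_eq] at hx
        linarith
      · have hz : coneLoop P x.1 = 0 := by simp [coneLoop, hs]
        exact hB0 (by rw [← hz, hPQ]; exact coneLoop_mem Q hQ h2 h4 ht)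
    · have hz := coneLoop_mem P hP h1 h3 hs
      by_cases ht : tent x.2 = 0
      · rw [hPQ] at hz
        exact hA0 (by simpa [coneLoop, ht] using hz)
      · exact disjoint_left.1 hAB hz (hPQ ▸ coneLoop_mem Q hQ h2 h4 ht)
  obtain ⟨L, hLc, hL⟩ := Complex.exists_continuousOn_eqOn_exp_comp hUsc hUo hFc.continuousOn h0
  have hL' : ∀ s t, (s, t) ∈ U → Complex.exp (L (s, t)) = coneLoop P s - coneLoop Q t :=
    fun s t h => hL h
  have hcont : ∀ c d c' d' : ℝ, (∀ t ∈ Icc (0:ℝ) 1, (c + d * t, c' + d' * t) ∈ U) →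
      ContinuousOn (fun t : ℝ => L (c + d * t, c' + d' * t)) (Icc 0 1) := fun c d c' d' h =>
    hLc.comp (by fun_prop) h
  have hcim : ∀ {g : ℝ → ℂ}, ContinuousOn g (Icc 0 1) →
      ContinuousOn (fun t => (g t).im) (Icc 0 1) :=
    fun h => Complex.continuous_im.comp_continuousOn h
  have memU : ∀ s t : ℝ, s + t < 7 / 2 → -(3 / 2) < s + t → s - t < 5 / 2 → t - s < 5 / 2 →
      (s, t) ∈ U := by
    intro s t _ _ _ _
    simp only [hU, mem_ofPred_eq]
    rcases abs_cases (s - 1 / 2) with h | h <;> rcases abs_cases (t - 1 / 2) with h' | h' <;>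
      linarith
  have Pm : coneLoop P (-1) = 0 := by rw [coneLoop_of_neg P] <;> norm_num
  have Pp : coneLoop P 2 = 0 := by rw [coneLoop_of_one_le P] <;> norm_num
  have Qm : coneLoop Q (-1) = 0 := by rw [coneLoop_of_neg Q] <;> norm_num
  have Qp : coneLoop Q 2 = 0 := by rw [coneLoop_of_one_le Q] <;> norm_num
  have c1 := im_log_lt_of_segment (a := e₃) (b := -e₂) (l := fun t => L (1 + 1 * t, -1 + 1 * t))
    (by simp only [mul_neg, Complex.neg_im, Complex.mul_im, Complex.conj_re,
          Complex.conj_im] at h23 ⊢; linarith)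
    (hcont _ _ _ _ fun t ht => memU _ _ (by linarith [ht.2]) (by linarith [ht.1])
      (by linarith) (by linarith))
    (by
      intro t ht
      rw [hL' _ _ (memU _ _ (by linarith [ht.2]) (by linarith [ht.1]) (by linarith) (by linarith)),
        coneLoop_of_one_le P (by linarith [ht.1]) (by linarith [ht.2]),
        coneLoop_of_neg Q (by linarith [ht.1]) (by linarith [ht.2])]
      push_cast; ring)
  have c2 := im_log_lt_of_segment (a := -e₄) (b := e₃) (l := fun t => L (2 + -1 * t, 1 + 1 * t))
    (by simp only [map_neg, neg_mul, Complex.neg_im, Complex.mul_im, Complex.conj_re,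
          Complex.conj_im] at h34 ⊢; linarith)
    (hcont _ _ _ _ fun t ht => memU _ _ (by linarith [ht.2]) (by linarith [ht.1])
      (by linarith [ht.1]) (by linarith [ht.2]))
    (by
      intro t ht
      rw [hL' _ _ (memU _ _ (by linarith [ht.2]) (by linarith [ht.1]) (by linarith [ht.1])
          (by linarith [ht.2])),
        coneLoop_of_one_le P (by linarith [ht.2]) (by linarith [ht.1]),
        coneLoop_of_one_le Q (by linarith [ht.1]) (by linarith [ht.2])]
      push_cast; ring)
  have c3 := im_log_lt_of_segment (a := e₁) (b := -e₄) (l := fun t => L (0 + -1 * t, 2 + -1 * t))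
    (by simp only [mul_neg, Complex.neg_im, Complex.mul_im, Complex.conj_re,
          Complex.conj_im] at h41 ⊢; linarith)
    (hcont _ _ _ _ fun t ht => memU _ _ (by linarith [ht.1]) (by linarith [ht.2])
      (by linarith [ht.1]) (by linarith [ht.2]))
    (by
      intro t ht
      rw [hL' _ _ (memU _ _ (by linarith [ht.1]) (by linarith [ht.2]) (by linarith [ht.1])
          (by linarith [ht.2])),
        coneLoop_of_neg P (by linarith [ht.2]) (by linarith [ht.1]),
        coneLoop_of_one_le Q (by linarith [ht.2]) (by linarith [ht.1])]
      push_cast; ring)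
  have c4 := im_log_lt_of_segment (a := -e₂) (b := e₁) (l := fun t => L (-1 + 1 * t, 0 + -1 * t))
    (by simp only [map_neg, neg_mul, Complex.neg_im, Complex.mul_im, Complex.conj_re,
          Complex.conj_im] at h12 ⊢; linarith)
    (hcont _ _ _ _ fun t ht => memU _ _ (by linarith [ht.1]) (by linarith [ht.2])
      (by linarith [ht.2]) (by linarith [ht.1]))
    (by
      intro t ht
      rw [hL' _ _ (memU _ _ (by linarith [ht.1]) (by linarith [ht.2]) (by linarith [ht.2])
          (by linarith [ht.1])),
        coneLoop_of_neg P (by linarith [ht.1]) (by linarith [ht.2]),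
        coneLoop_of_neg Q (by linarith [ht.2]) (by linarith [ht.1])]
      push_cast; ring)
  have mem1 : ∀ t ∈ Icc (0:ℝ) 1, (0 + 1 * t, 2 + 0 * t) ∈ U := fun t ht =>
    memU _ _ (by linarith [ht.2]) (by linarith [ht.1]) (by linarith [ht.2]) (by linarith [ht.1])
  have mem2 : ∀ t ∈ Icc (0:ℝ) 1, (0 + 1 * t, -1 + 0 * t) ∈ U := fun t ht =>
    memU _ _ (by linarith [ht.2]) (by linarith [ht.1]) (by linarith [ht.2]) (by linarith [ht.1])
  have mem3 : ∀ t ∈ Icc (0:ℝ) 1, (2 + 0 * t, 0 + 1 * t) ∈ U := fun t ht =>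
    memU _ _ (by linarith [ht.2]) (by linarith [ht.1]) (by linarith [ht.1]) (by linarith [ht.2])
  have mem4 : ∀ t ∈ Icc (0:ℝ) 1, (-1 + 0 * t, 0 + 1 * t) ∈ U := fun t ht =>
    memU _ _ (by linarith [ht.2]) (by linarith [ht.1]) (by linarith [ht.1]) (by linarith [ht.2])
  have s1 := eq_of_cos_sub_eq_one (hcim (hcont _ _ _ _ mem1)) (hcim (hcont _ _ _ _ mem2))
    (fun t ht => cos_im_sub_eq_one (by
      rw [hL' _ _ (mem1 t ht), hL' _ _ (mem2 t ht)]; norm_num [Qm, Qp]))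
  have s2 := eq_of_cos_sub_eq_one (hcim (hcont _ _ _ _ mem3)) (hcim (hcont _ _ _ _ mem4))
    (fun t ht => cos_im_sub_eq_one (by
      rw [hL' _ _ (mem3 t ht), hL' _ _ (mem4 t ht)]; norm_num [Pm, Pp]))
  norm_num at c1 c2 c3 c4 s1 s2
  linarith

section Leading

open Topology Filter Asymptotics

variable {E F : Type*} [NormedAddCommGroup E] [NormedSpace ℝ E] [NormedAddCommGroup F]
  [NormedSpace ℝ F]

theorem HasFPowerSeriesAt.isBigO_pow_of_forall_lt_eq_zero {f : E → F}
    {p : FormalMultilinearSeries ℝ E F} {x : E} (hf : HasFPowerSeriesAt f p x) {k : ℕ}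
    (hp : ∀ j < k, p j = 0) : (fun y => f (x + y)) =O[𝓝 0] fun y => ‖y‖ ^ k := by
  have h := hf.isBigO_sub_partialSum_pow k
  refine h.congr_left fun y => ?_
  have : p.partialSum k y = 0 := by
    rw [FormalMultilinearSeries.partialSum]
    exact Finset.sum_eq_zero fun j hj => by rw [hp j (Finset.mem_range.1 hj)]; rfl
  rw [this, sub_zero]

theorem HasFPowerSeriesAt.exists_fderiv_of_forall_lt_eq_zero [CompleteSpace F] {f : E → F}
    {p : FormalMultilinearSeries ℝ E F} {x : E} (hf : HasFPowerSeriesAt f p x) {k : ℕ}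
    (hp : ∀ j < k + 1, p j = 0) : ∃ p' : FormalMultilinearSeries ℝ E (E →L[ℝ] F),
      HasFPowerSeriesAt (fderiv ℝ f) p' x ∧ ∀ j < k, p' j = 0 := by
  obtain ⟨r, hr⟩ := hf
  exact ⟨p.derivSeries, ⟨r, hr.fderiv⟩, fun j hj => p.derivSeries_eq_zero (hp _ (by omega))⟩

/-- An analytic function that is not locally zero is, up to second derivatives, asymptotic to a
nonzero homogeneous function. -/
theorem AnalyticAt.exists_homogeneous_leading {v : E → ℝ} {x : E} (hv : AnalyticAt ℝ v x)
    (h0 : v x = 0) (h1 : fderiv ℝ v x = 0) (hne : ¬ ∀ᶠ y in 𝓝 x, v y = 0) :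
    ∃ (n : ℕ) (h : E → ℝ), ContDiff ℝ 2 h ∧ (∀ (t : ℝ) (y : E), h (t • y) = t ^ (n + 2) * h y) ∧
      (∃ y, h y ≠ 0) ∧
      ((fun y => v (x + y) - h y) =O[𝓝 0] fun y => ‖y‖ ^ (n + 3)) ∧
      ((fun y => fderiv ℝ v (x + y) - fderiv ℝ h y) =O[𝓝 0] fun y => ‖y‖ ^ (n + 2)) ∧
      ((fun y => fderiv ℝ (fderiv ℝ v) (x + y) - fderiv ℝ (fderiv ℝ h) y)
        =O[𝓝 0] fun y => ‖y‖ ^ (n + 1)) := by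
  classical
  obtain ⟨p, hp⟩ := hv
  have hex : ∃ m, ∃ y, p m (fun _ => y) ≠ 0 := by
    by_contra! hall
    refine hne ?_
    obtain ⟨r, hr⟩ := hp
    filter_upwards [Metric.eball_mem_nhds x hr.r_pos] with z hz
    have hs := hr.hasSum (y := z - x) (by simpa [edist_eq_enorm_sub] using hz)
    simp only [hall, add_sub_cancel] at hs
    exact hs.unique hasSum_zero
  obtain ⟨m, ⟨y₀, hy₀⟩, hmin⟩ : ∃ m, (∃ y, p m (fun _ => y) ≠ 0) ∧
      ∀ j < m, ∀ y, p j (fun _ => y) = 0 :=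
    ⟨Nat.find hex, Nat.find_spec hex, fun j hj y => by
      by_contra hc; exact Nat.find_min hex hj ⟨y, hc⟩⟩
  have hm2 : 2 ≤ m := by
    by_contra! hlt
    interval_cases m
    · exact hy₀ (by rw [hp.coeff_zero, h0])
    · refine hy₀ ?_
      have := hp.fderiv_eq
      rw [h1] at this
      have := congrArg (fun l => l y₀) this
      simp only [zero_apply, continuousMultilinearCurryFin1_apply] at this
      rw [this]
      congr 1
  obtain ⟨n, rfl⟩ := Nat.exists_eq_add_of_le' hm2
  set h : E → ℝ := fun y => p (n + 2) (fun _ => y) with hh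
  have hC : ContDiff ℝ 3 h :=
    (p (n + 2)).contDiff.comp (contDiff_pi.2 fun _ => contDiff_id)
  have hhom : ∀ (t : ℝ) (y : E), h (t • y) = t ^ (n + 2) * h y := fun t y => by
    have := (p (n + 2)).map_smul_univ (fun _ => t) (fun _ => y)
    simpa [hh] using this
  set q : FormalMultilinearSeries ℝ E ℝ := fun j => if j < n + 3 then 0 else p j with hq
  set R : E → ℝ := fun z => v z - h (z - x) with hR
  have hqR : HasFPowerSeriesAt R q x := by
    obtain ⟨r, hr⟩ := hp
    refine ⟨r, hr.r_le.trans (FormalMultilinearSeries.radius_le_of_le fun j => ?_), hr.r_pos, ?_⟩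
    · simp only [hq]; split_ifs <;> simp
    · intro y hy
      have hs := (hr.hasSum hy).sub (hasSum_ite_eq (n + 2) (h y))
      simp only [hR, add_sub_cancel_left]
      convert! hs using 2 with j
      simp only [hq]
      rcases lt_trichotomy j (n + 2) with hj | hj | hj
      · rw [if_pos (by omega), if_neg (by omega), hmin j hj]; simp
      · subst hj; simp [hh]
      · rw [if_neg (by omega), if_neg (by omega)]; simp
  have hq0 : ∀ j < n + 3, q j = 0 := fun j hj => if_pos hj
  obtain ⟨q₁, hqR1, hq1⟩ := hqR.exists_fderiv_of_forall_lt_eq_zero (k := n + 2) hq0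
  obtain ⟨q₂, hqR2, hq2⟩ := hqR1.exists_fderiv_of_forall_lt_eq_zero (k := n + 1) hq1
  have hd1 : ∀ᶠ z in 𝓝 x, fderiv ℝ R z = fderiv ℝ v z - fderiv ℝ h (z - x) := by
    have hva : AnalyticAt ℝ v x := ⟨p, hp⟩
    filter_upwards [hva.eventually_analyticAt] with z hz
    have hd : DifferentiableAt ℝ (fun y => h (y - x)) z :=
      ((hC.differentiable (by norm_num)) _).comp z (differentiableAt_id.sub_const x)
    rw [hR, fderiv_fun_sub hz.differentiableAt hd, fderiv_comp_sub]
  have hd2 : ∀ᶠ z in 𝓝 x, fderiv ℝ (fderiv ℝ R) z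
      = fderiv ℝ (fderiv ℝ v) z - fderiv ℝ (fderiv ℝ h) (z - x) := by
    have hva : AnalyticAt ℝ v x := ⟨p, hp⟩
    have hC1 : ContDiff ℝ 2 (fderiv ℝ h) := hC.fderiv_right (by norm_num)
    filter_upwards [hd1.eventually_nhds, hva.eventually_analyticAt] with z hz hz'
    have hd : DifferentiableAt ℝ (fun y => fderiv ℝ h (y - x)) z :=
      ((hC1.differentiable (by norm_num)) _).comp z (differentiableAt_id.sub_const x)
    rw [Filter.EventuallyEq.fderiv_eq hz, fderiv_fun_sub hz'.fderiv.differentiableAt hd,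
      fderiv_comp_sub]
  have hshift : Tendsto (fun y : E => x + y) (𝓝 0) (𝓝 x) := by
    have : Tendsto (fun y : E => x + y) (𝓝 0) (𝓝 (x + 0)) := tendsto_id.const_add x
    simpa using this
  refine ⟨n, h, hC.of_le (by norm_num), hhom, ⟨y₀, hy₀⟩, ?_, ?_, ?_⟩
  · simpa [hR] using hqR.isBigO_pow_of_forall_lt_eq_zero hq0
  · refine (hqR1.isBigO_pow_of_forall_lt_eq_zero hq1).congr' ?_ EventuallyEq.rfl
    filter_upwards [hshift.eventually hd1] with y hy
    simp [hy]
  · refine (hqR2.isBigO_pow_of_forall_lt_eq_zero hq2).congr' ?_ EventuallyEq.rfl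
    filter_upwards [hshift.eventually hd2] with y hy
    simp [hy]

variable {n : ℕ} {h : E → ℝ}

theorem fderiv_smul_of_homogeneous (hhom : ∀ (t : ℝ) (y : E), h (t • y) = t ^ (n + 2) * h y)
    (hC : ContDiff ℝ 2 h) {t : ℝ} (ht : t ≠ 0) (y : E) :
    fderiv ℝ h (t • y) = t ^ (n + 1) • fderiv ℝ h y := by
  have h1 : fderiv ℝ (fun y => h (t • y)) y = t • fderiv ℝ h (t • y) := fderiv_comp_smul ..
  have h2 : fderiv ℝ (fun y => h (t • y)) y = t ^ (n + 2) • fderiv ℝ h y := by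
    simp only [hhom]
    exact fderiv_const_mul ((hC.differentiable (by norm_num)) y) _
  rw [h1, pow_succ', mul_smul] at h2
  exact smul_right_injective _ ht h2

theorem fderiv_fderiv_smul_of_homogeneous
    (hhom : ∀ (t : ℝ) (y : E), h (t • y) = t ^ (n + 2) * h y)
    (hC : ContDiff ℝ 2 h) {t : ℝ} (ht : t ≠ 0) (y : E) :
    fderiv ℝ (fderiv ℝ h) (t • y) = t ^ n • fderiv ℝ (fderiv ℝ h) y := by
  have hC1 : ContDiff ℝ 1 (fderiv ℝ h) := hC.fderiv_right (by norm_num)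
  have h1 : fderiv ℝ (fun y => fderiv ℝ h (t • y)) y = t • fderiv ℝ (fderiv ℝ h) (t • y) :=
    fderiv_comp_smul ..
  have h2 : fderiv ℝ (fun y => fderiv ℝ h (t • y)) y
      = t ^ (n + 1) • fderiv ℝ (fderiv ℝ h) y := by
    simp only [fderiv_smul_of_homogeneous hhom hC ht]
    exact (((hC1.differentiable (by norm_num)) y).hasFDerivAt.const_smul (t ^ (n + 1))).fderiv
  rw [h1, pow_succ', mul_smul] at h2
  exact smul_right_injective _ ht h2

/-- Euler's identity. -/
theorem fderiv_apply_self_of_homogeneous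
    (hhom : ∀ (t : ℝ) (y : E), h (t • y) = t ^ (n + 2) * h y)
    (hC : ContDiff ℝ 2 h) (y : E) : fderiv ℝ h y y = (n + 2) * h y := by
  have h1 : HasDerivAt (fun t : ℝ => h (t • y)) (fderiv ℝ h ((1:ℝ) • y) ((1:ℝ) • y)) 1 :=
    ((hC.differentiable (by norm_num)) _).hasFDerivAt.comp_hasDerivAt (1:ℝ)
      ((hasDerivAt_id (1:ℝ)).smul_const y)
  have h2 : HasDerivAt (fun t : ℝ => h (t • y)) ((n + 2) * h y) 1 := by
    simp only [hhom]
    have := (hasDerivAt_pow (n + 2) (1:ℝ)).mul_const (h y)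
    simpa using this
  simpa using h1.unique h2

theorem fderiv_fderiv_apply_self_of_homogeneous
    (hhom : ∀ (t : ℝ) (y : E), h (t • y) = t ^ (n + 2) * h y)
    (hC : ContDiff ℝ 2 h) (y : E) :
    fderiv ℝ (fderiv ℝ h) y y y = (n + 1) * (n + 2) * h y := by
  have hC1 : ContDiff ℝ 1 (fderiv ℝ h) := hC.fderiv_right (by norm_num)
  have hd := ((hC1.differentiable (by norm_num)) y).hasFDerivAt
  have h1 := hd.clm_apply (hasFDerivAt_id y)
  have h2 : HasFDerivAt (fun y => fderiv ℝ h y (id y)) ((n + 2 : ℝ) • fderiv ℝ h y) y := by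
    simp only [id, fderiv_apply_self_of_homogeneous hhom hC]
    exact ((hC.differentiable (by norm_num)) y).hasFDerivAt.const_mul _
  have h3 := congrArg (fun l => l y) (h1.unique h2)
  simp [fderiv_apply_self_of_homogeneous hhom hC] at h3
  linear_combination h3

/-- Solutions of the harmonic oscillator. -/
theorem eq_cos_add_sin_of_deriv_deriv {k : ℝ} (hk : 0 < k) {g g' : ℝ → ℝ}
    (hg : ∀ θ, HasDerivAt g (g' θ) θ) (hg' : ∀ θ, HasDerivAt g' (-(k ^ 2) * g θ) θ) :
    ∃ a b : ℝ, ∀ θ, g θ = a * Real.cos (k * θ) + b * Real.sin (k * θ) := by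
  refine ⟨g 0, g' 0 / k, ?_⟩
  set a := g 0
  set b := g' 0 / k with hb
  have hkb : k * b = g' 0 := by rw [hb]; field_simp
  have hlin : ∀ θ : ℝ, HasDerivAt (fun θ => k * θ) k θ := fun θ => by
    simpa using (hasDerivAt_id θ).const_mul k
  have hw : ∀ θ, HasDerivAt (fun θ => g θ - (a * Real.cos (k * θ) + b * Real.sin (k * θ)))
      (g' θ - (a * (-Real.sin (k * θ) * k) + b * (Real.cos (k * θ) * k))) θ := fun θ =>
    (hg θ).sub (((hlin θ).cos.const_mul a).add ((hlin θ).sin.const_mul b))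
  have hw' : ∀ θ, HasDerivAt
      (fun θ => g' θ - (a * (-Real.sin (k * θ) * k) + b * (Real.cos (k * θ) * k)))
      (-(k ^ 2) * g θ - (a * (-(Real.cos (k * θ) * k) * k) + b * (-Real.sin (k * θ) * k * k)))
      θ := fun θ =>
    (hg' θ).sub ((((hlin θ).sin.neg.mul_const k).const_mul a).add
      (((hlin θ).cos.mul_const k).const_mul b))
  have hen : ∀ θ, HasDerivAt (fun θ =>
      (g' θ - (a * (-Real.sin (k * θ) * k) + b * (Real.cos (k * θ) * k))) ^ 2
      + k ^ 2 * (g θ - (a * Real.cos (k * θ) + b * Real.sin (k * θ))) ^ 2) 0 θ := fun θ => by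
    refine (((hw' θ).pow 2).add (((hw θ).pow 2).const_mul (k ^ 2))).congr_deriv ?_
    push_cast
    ring
  intro θ
  have hc := is_const_of_deriv_eq_zero (fun θ => (hen θ).differentiableAt)
    (fun θ => (hen θ).deriv) θ 0
  have h0 : g' 0 - (a * (-Real.sin (k * 0) * k) + b * (Real.cos (k * 0) * k)) = 0 := by
    simp; linarith
  have h0' : g 0 - (a * Real.cos (k * 0) + b * Real.sin (k * 0)) = 0 := by simp [a]
  simp only [h0, h0'] at hc
  have hsq : k ^ 2 * (g θ - (a * Real.cos (k * θ) + b * Real.sin (k * θ))) ^ 2 = 0 := by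
    nlinarith [sq_nonneg (g' θ - (a * (-Real.sin (k * θ) * k) + b * (Real.cos (k * θ) * k))),
      mul_nonneg (sq_nonneg k) (sq_nonneg (g θ - (a * Real.cos (k * θ) + b * Real.sin (k * θ))))]
  have := (mul_eq_zero.1 hsq).resolve_left (by positivity)
  linarith [pow_eq_zero_iff (two_ne_zero) |>.1 this]

/-- A homogeneous function annihilated by `∂²_{m₁} + ∂²_{m₂}` is trigonometric on ellipses. -/
theorem exists_trig_of_homogeneous (hhom : ∀ (t : ℝ) (y : E), h (t • y) = t ^ (n + 2) * h y)
    (hC : ContDiff ℝ 2 h) {m₁ m₂ : E}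
    (hL : ∀ y, fderiv ℝ (fderiv ℝ h) y m₁ m₁ + fderiv ℝ (fderiv ℝ h) y m₂ m₂ = 0) :
    ∃ a b : ℝ, ∀ θ : ℝ, h (Real.cos θ • m₁ + Real.sin θ • m₂)
      = a * Real.cos ((n + 2 : ℝ) * θ) + b * Real.sin ((n + 2 : ℝ) * θ) := by
  have hC1 : ContDiff ℝ 1 (fderiv ℝ h) := hC.fderiv_right (by norm_num)
  have hc : ∀ θ : ℝ, HasDerivAt (fun θ => Real.cos θ • m₁ + Real.sin θ • m₂)
      (-Real.sin θ • m₁ + Real.cos θ • m₂) θ := fun θ =>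
    ((Real.hasDerivAt_cos θ).smul_const m₁).add ((Real.hasDerivAt_sin θ).smul_const m₂)
  have hc' : ∀ θ : ℝ, HasDerivAt (fun θ => -Real.sin θ • m₁ + Real.cos θ • m₂)
      (-Real.cos θ • m₁ + -Real.sin θ • m₂) θ := fun θ =>
    ((Real.hasDerivAt_sin θ).neg.smul_const m₁).add ((Real.hasDerivAt_cos θ).smul_const m₂)
  refine eq_cos_add_sin_of_deriv_deriv (k := n + 2) (by positivity)
    (g' := fun θ => fderiv ℝ h (Real.cos θ • m₁ + Real.sin θ • m₂)
      (-Real.sin θ • m₁ + Real.cos θ • m₂))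
    (fun θ => ((hC.differentiable (by norm_num)) _).hasFDerivAt.comp_hasDerivAt θ (hc θ))
    (fun θ => ?_)
  have h1 : HasDerivAt (fun θ => fderiv ℝ h (Real.cos θ • m₁ + Real.sin θ • m₂))
      (fderiv ℝ (fderiv ℝ h) (Real.cos θ • m₁ + Real.sin θ • m₂)
        (-Real.sin θ • m₁ + Real.cos θ • m₂)) θ :=
    ((hC1.differentiable (by norm_num)) _).hasFDerivAt.comp_hasDerivAt θ (hc θ)
  refine (h1.clm_apply (hc' θ)).congr_deriv ?_
  have e1 := fderiv_apply_self_of_homogeneous hhom hC (Real.cos θ • m₁ + Real.sin θ • m₂)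
  have e2 := fderiv_fderiv_apply_self_of_homogeneous hhom hC (Real.cos θ • m₁ + Real.sin θ • m₂)
  have e3 := hL (Real.cos θ • m₁ + Real.sin θ • m₂)
  generalize fderiv ℝ (fderiv ℝ h) (Real.cos θ • m₁ + Real.sin θ • m₂) = D at *
  generalize fderiv ℝ h (Real.cos θ • m₁ + Real.sin θ • m₂) = D₁ at *
  simp only [map_add, map_smul, add_apply, smul_apply, smul_eq_mul] at e1 e2 ⊢
  have cs := Real.sin_sq_add_cos_sq θ
  linear_combination (D m₁ m₁ + D m₂ m₂) * cs - e1 - e2 + e3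

/-- A nonzero trigonometric monomial of degree at least two alternates in sign on four
directions not contained in a half-plane. -/
theorem exists_alternating_angles (n : ℕ) {a b : ℝ} (hab : a ≠ 0 ∨ b ≠ 0) :
    ∃ θ₁ θ₂ θ₃ θ₄ : ℝ, 0 < Real.sin (θ₂ - θ₁) ∧ 0 < Real.sin (θ₃ - θ₂) ∧
      0 < Real.sin (θ₄ - θ₃) ∧ 0 < Real.sin (θ₁ - θ₄) ∧
      0 < a * Real.cos ((n + 2 : ℝ) * θ₁) + b * Real.sin ((n + 2 : ℝ) * θ₁) ∧
      a * Real.cos ((n + 2 : ℝ) * θ₂) + b * Real.sin ((n + 2 : ℝ) * θ₂) < 0 ∧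
      0 < a * Real.cos ((n + 2 : ℝ) * θ₃) + b * Real.sin ((n + 2 : ℝ) * θ₃) ∧
      a * Real.cos ((n + 2 : ℝ) * θ₄) + b * Real.sin ((n + 2 : ℝ) * θ₄) < 0 := by
  set k : ℝ := n + 2 with hk
  have hk2 : 2 ≤ k := by rw [hk]; have : (0:ℝ) ≤ n := n.cast_nonneg; linarith
  have hk0 : 0 < k := by linarith
  obtain ⟨R, φ, hR, ha, hb⟩ : ∃ R φ : ℝ, 0 < R ∧ a = R * Real.cos φ ∧ b = R * Real.sin φ := by
    have hz : (⟨a, b⟩ : ℂ) ≠ 0 := by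
      intro h
      have h1 := congrArg Complex.re h
      have h2 := congrArg Complex.im h
      simp at h1 h2
      tauto
    exact ⟨‖(⟨a, b⟩ : ℂ)‖, Complex.arg ⟨a, b⟩, norm_pos_iff.2 hz,
      (Complex.norm_mul_cos_arg ⟨a, b⟩).symm, (Complex.norm_mul_sin_arg ⟨a, b⟩).symm⟩
  have hval : ∀ s, a * Real.cos (k * (φ / k + s)) + b * Real.sin (k * (φ / k + s))
      = R * Real.cos (k * s) := by
    intro s
    have : k * s = k * (φ / k + s) - φ := by field_simp; ring
    rw [this, Real.cos_sub, ha, hb]; ring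
  have hpi := Real.pi_pos
  have hpk : Real.pi / k ≤ Real.pi / 2 := div_le_div_of_nonneg_left hpi.le two_pos hk2
  have hpk0 : 0 < Real.pi / k := by positivity
  rcases Nat.even_or_odd n with hn | hn
  · have hkpi : Real.cos (k * Real.pi) = 1 := by
      obtain ⟨m, rfl⟩ := hn
      rw [hk, show ((m + m : ℕ) + 2 : ℝ) * Real.pi = ((m + 1 : ℕ) : ℝ) * (2 * Real.pi) by
        push_cast; ring]
      exact Real.cos_nat_mul_two_pi _
    refine ⟨φ / k + 0, φ / k + Real.pi / k, φ / k + Real.pi, φ / k + (Real.pi + Real.pi / k),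
      ?_, ?_, ?_, ?_, ?_, ?_, ?_, ?_⟩
    · exact Real.sin_pos_of_pos_of_lt_pi (by linarith) (by linarith)
    · exact Real.sin_pos_of_pos_of_lt_pi (by linarith) (by linarith)
    · exact Real.sin_pos_of_pos_of_lt_pi (by linarith) (by linarith)
    · rw [← Real.sin_add_two_pi]
      exact Real.sin_pos_of_pos_of_lt_pi (by linarith) (by linarith)
    · rw [hval]; simpa using hR
    · rw [hval, mul_div_cancel₀ _ hk0.ne', Real.cos_pi]; linarith
    · rw [hval, hkpi]; linarith
    · rw [hval, mul_add, mul_div_cancel₀ _ hk0.ne', Real.cos_add_pi, hkpi]; linarith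
  · have hn1 : (1:ℝ) ≤ n := by exact_mod_cast hn.pos
    have hk3 : 3 ≤ k := by rw [hk]; linarith
    have hpk3 : Real.pi / k ≤ Real.pi / 3 := div_le_div_of_nonneg_left hpi.le three_pos hk3
    have hkpi : Real.cos (k * Real.pi + Real.pi / 4) = -Real.cos (Real.pi / 4) := by
      obtain ⟨m, rfl⟩ := hn
      rw [hk, show ((2 * m + 1 : ℕ) + 2 : ℝ) * Real.pi + Real.pi / 4
        = (Real.pi / 4 + Real.pi) + ((m + 1 : ℕ) : ℝ) * (2 * Real.pi) by push_cast; ring,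
        Real.cos_add_nat_mul_two_pi, Real.cos_add_pi]
    have hc4 : 0 < Real.cos (Real.pi / 4) :=
      Real.cos_pos_of_mem_Ioo ⟨by linarith, by linarith⟩
    refine ⟨φ / k + 0, φ / k + Real.pi / k, φ / k + 2 * (Real.pi / k),
      φ / k + (Real.pi + Real.pi / k / 4), ?_, ?_, ?_, ?_, ?_, ?_, ?_, ?_⟩
    · exact Real.sin_pos_of_pos_of_lt_pi (by linarith) (by linarith)
    · exact Real.sin_pos_of_pos_of_lt_pi (by linarith) (by linarith)
    · exact Real.sin_pos_of_pos_of_lt_pi (by linarith) (by linarith)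
    · rw [← Real.sin_add_two_pi]
      exact Real.sin_pos_of_pos_of_lt_pi (by linarith) (by linarith)
    · rw [hval]; simpa using hR
    · rw [hval, mul_div_cancel₀ _ hk0.ne', Real.cos_pi]; linarith
    · rw [hval, show k * (2 * (Real.pi / k)) = 2 * Real.pi by field_simp, Real.cos_two_pi]
      linarith
    · rw [hval, show k * (Real.pi + Real.pi / k / 4) = k * Real.pi + Real.pi / 4 by field_simp,
        hkpi]
      nlinarith

theorem tendsto_inv_pow_smul_of_isBigO {G : Type*} [NormedAddCommGroup G] [NormedSpace ℝ G]
    {f g : E → G} {j : ℕ} (hfg : (fun y => f y - g y) =O[𝓝 0] fun y => ‖y‖ ^ (j + 1))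
    (hg : ∀ t : ℝ, t ≠ 0 → ∀ y, g (t • y) = t ^ j • g y) (d : E) :
    Tendsto (fun t : ℝ => (t ^ j)⁻¹ • f (t • d)) (𝓝[>] 0) (𝓝 (g d)) := by
  have ht : Tendsto (fun t : ℝ => t • d) (𝓝[>] 0) (𝓝 0) := by
    have : Tendsto (fun t : ℝ => t • d) (𝓝 0) (𝓝 ((0:ℝ) • d)) :=
      (tendsto_id (α := ℝ)).smul_const d
    rw [zero_smul] at this
    exact this.mono_left nhdsWithin_le_nhds
  obtain ⟨C, hC⟩ := (hfg.comp_tendsto ht).bound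
  rw [tendsto_iff_norm_sub_tendsto_zero]
  have hlim : Tendsto (fun t : ℝ => C * ‖d‖ ^ (j + 1) * t) (𝓝[>] 0) (𝓝 0) := by
    have : Tendsto (fun t : ℝ => C * ‖d‖ ^ (j + 1) * t) (𝓝 0) (𝓝 (C * ‖d‖ ^ (j + 1) * 0)) :=
      (tendsto_id (α := ℝ)).const_mul _
    rw [mul_zero] at this
    exact this.mono_left nhdsWithin_le_nhds
  refine squeeze_zero' (Eventually.of_forall fun _ => norm_nonneg _) ?_ hlim
  filter_upwards [hC, self_mem_nhdsWithin] with t h1 (h2 : 0 < t)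
  have e : (t ^ j)⁻¹ • f (t • d) - g d = (t ^ j)⁻¹ • (f (t • d) - g (t • d)) := by
    rw [hg t h2.ne', smul_sub, smul_smul, inv_mul_cancel₀ (by positivity), one_smul]
  rw [e, norm_smul, norm_inv, norm_pow, Real.norm_of_nonneg h2.le]
  simp only [Function.comp_apply, norm_smul, Real.norm_of_nonneg h2.le, norm_pow, norm_norm,
    norm_mul] at h1
  calc (t ^ j)⁻¹ * ‖f (t • d) - g (t • d)‖ ≤ (t ^ j)⁻¹ * (C * (t * ‖d‖) ^ (j + 1)) := by gcongr
    _ = C * ‖d‖ ^ (j + 1) * t := by rw [mul_pow, pow_succ t]; field_simp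

/-- At a degenerate zero, a nontrivial analytic solution of a planar elliptic equation takes
alternating signs along four rays not contained in a half-plane. -/
theorem exists_alternating_rays {v : E → ℝ} {x : E} (hv : AnalyticAt ℝ v x)
    (h0 : v x = 0) (h1 : fderiv ℝ v x = 0) (hne : ¬ ∀ᶠ y in 𝓝 x, v y = 0)
    {a₁ a₂ : E} {α β δ b₁ b₂ c : E → ℝ}
    (hα : ContinuousAt α x) (hβ : ContinuousAt β x) (hδ : ContinuousAt δ x)
    (hb₁ : ContinuousAt b₁ x) (hb₂ : ContinuousAt b₂ x) (hc : ContinuousAt c x)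
    (hpde : ∀ᶠ y in 𝓝 x, α y * fderiv ℝ (fderiv ℝ v) y a₁ a₁
      + β y * fderiv ℝ (fderiv ℝ v) y a₁ a₂ + δ y * fderiv ℝ (fderiv ℝ v) y a₂ a₂
      + b₁ y * fderiv ℝ v y a₁ + b₂ y * fderiv ℝ v y a₂ + c y * v y = 0)
    {m₁ m₂ : E} (hx : ∀ D : E →L[ℝ] E →L[ℝ] ℝ,
      α x * D a₁ a₁ + β x * D a₁ a₂ + δ x * D a₂ a₂ = D m₁ m₁ + D m₂ m₂)
    (hspan : ∀ y : E, ∃ r θ : ℝ, y = r • (Real.cos θ • m₁ + Real.sin θ • m₂)) :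
    ∃ θ₁ θ₂ θ₃ θ₄ : ℝ, 0 < Real.sin (θ₂ - θ₁) ∧ 0 < Real.sin (θ₃ - θ₂) ∧
      0 < Real.sin (θ₄ - θ₃) ∧ 0 < Real.sin (θ₁ - θ₄) ∧
      (∀ᶠ t in 𝓝[>] (0:ℝ), 0 < v (x + t • (Real.cos θ₁ • m₁ + Real.sin θ₁ • m₂))) ∧
      (∀ᶠ t in 𝓝[>] (0:ℝ), v (x + t • (Real.cos θ₂ • m₁ + Real.sin θ₂ • m₂)) < 0) ∧
      (∀ᶠ t in 𝓝[>] (0:ℝ), 0 < v (x + t • (Real.cos θ₃ • m₁ + Real.sin θ₃ • m₂))) ∧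
      (∀ᶠ t in 𝓝[>] (0:ℝ), v (x + t • (Real.cos θ₄ • m₁ + Real.sin θ₄ • m₂)) < 0) := by
  obtain ⟨n, h, hC, hhom, ⟨y₀, hy₀⟩, hO0, hO1, hO2⟩ :=
    hv.exists_homogeneous_leading h0 h1 hne
  have lim0 := tendsto_inv_pow_smul_of_isBigO (f := fun y => v (x + y)) (g := h) (j := n + 2)
    hO0 (fun t _ y => hhom t y)
  have lim1 := tendsto_inv_pow_smul_of_isBigO (f := fun y => fderiv ℝ v (x + y))
    (g := fderiv ℝ h) (j := n + 1) hO1 (fun t ht y => fderiv_smul_of_homogeneous hhom hC ht y)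
  have lim2 := tendsto_inv_pow_smul_of_isBigO (f := fun y => fderiv ℝ (fderiv ℝ v) (x + y))
    (g := fderiv ℝ (fderiv ℝ h)) (j := n) hO2
    (fun t ht y => fderiv_fderiv_smul_of_homogeneous hhom hC ht y)
  have hL : ∀ y, fderiv ℝ (fderiv ℝ h) y m₁ m₁ + fderiv ℝ (fderiv ℝ h) y m₂ m₂ = 0 := by
    intro y
    rw [← hx]
    have hxt : Tendsto (fun t : ℝ => x + t • y) (𝓝[>] 0) (𝓝 x) := by
      have : Tendsto (fun t : ℝ => x + t • y) (𝓝 0) (𝓝 (x + (0:ℝ) • y)) :=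
        ((tendsto_id (α := ℝ)).smul_const y).const_add x
      rw [zero_smul, add_zero] at this
      exact this.mono_left nhdsWithin_le_nhds
    have ht : Tendsto (fun t : ℝ => t) (𝓝[>] 0) (𝓝 0) := nhdsWithin_le_nhds
    have l1 : ∀ w, Tendsto (fun t : ℝ => ((t ^ (n + 1))⁻¹ • fderiv ℝ v (x + t • y)) w)
        (𝓝[>] 0) (𝓝 (fderiv ℝ h y w)) := fun w => ((ContinuousLinearMap.apply ℝ ℝ w).continuous.tendsto _).comp (lim1 y)
    have l2 : ∀ w w', Tendsto
        (fun t : ℝ => ((t ^ n)⁻¹ • fderiv ℝ (fderiv ℝ v) (x + t • y)) w w')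
        (𝓝[>] 0) (𝓝 (fderiv ℝ (fderiv ℝ h) y w w')) := fun w w' =>
      ((ContinuousLinearMap.apply ℝ ℝ w').continuous.tendsto _).comp
        (((ContinuousLinearMap.apply ℝ (E →L[ℝ] ℝ) w).continuous.tendsto _).comp (lim2 y))
    have A := (((((hα.tendsto.comp hxt).mul (l2 a₁ a₁)).add
      ((hβ.tendsto.comp hxt).mul (l2 a₁ a₂))).add ((hδ.tendsto.comp hxt).mul (l2 a₂ a₂))).add
      (ht.mul (((hb₁.tendsto.comp hxt).mul (l1 a₁)).add
        ((hb₂.tendsto.comp hxt).mul (l1 a₂))))).add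
      ((ht.mul ht).mul ((hc.tendsto.comp hxt).mul (lim0 y)))
    simp only [zero_mul, add_zero] at A
    refine tendsto_nhds_unique A (tendsto_const_nhds.congr' ?_)
    filter_upwards [hxt.eventually hpde, self_mem_nhdsWithin] with t hp (htpos : 0 < t)
    rw [← mul_zero (t ^ n)⁻¹, ← hp]
    simp only [Function.comp_apply, smul_apply, smul_eq_mul, pow_succ]
    field_simp
    try ring
  obtain ⟨a, b, hab⟩ := exists_trig_of_homogeneous hhom hC hL
  have hne' : a ≠ 0 ∨ b ≠ 0 := by
    by_contra! hz
    obtain ⟨r, θ, rfl⟩ := hspan y₀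
    exact hy₀ (by rw [hhom, hab, hz.1, hz.2]; simp)
  obtain ⟨θ₁, θ₂, θ₃, θ₄, s1, s2, s3, s4, p1, p2, p3, p4⟩ := exists_alternating_angles n hne'
  rw [← hab] at p1 p2 p3 p4
  have pos : ∀ d, 0 < h d → ∀ᶠ t in 𝓝[>] (0:ℝ), 0 < v (x + t • d) := fun d hd => by
    filter_upwards [(lim0 d).eventually_const_lt hd, self_mem_nhdsWithin] with t h1 (h2 : 0 < t)
    rw [smul_eq_mul] at h1
    exact (pos_iff_pos_of_mul_pos h1).1 (by positivity)
  have neg : ∀ d, h d < 0 → ∀ᶠ t in 𝓝[>] (0:ℝ), v (x + t • d) < 0 := fun d hd => by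
    filter_upwards [(lim0 d).eventually_lt_const hd, self_mem_nhdsWithin] with t h1 (h2 : 0 < t)
    rw [smul_eq_mul] at h1
    by_contra! hc
    exact absurd h1 (not_lt.2 (mul_nonneg (by positivity) hc))
  exact ⟨θ₁, θ₂, θ₃, θ₄, s1, s2, s3, s4, pos _ p1, neg _ p2, pos _ p3, neg _ p4⟩

end Leading

section MinPrinciple

open Topology Filter

variable {E : Type*} [NormedAddCommGroup E] [NormedSpace ℝ E]

theorem IsLocalMin.fderiv_fderiv_apply_self_nonneg {φ : E → ℝ} {x : E} (h : IsLocalMin φ x)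
    (hφ : ContDiffAt ℝ 2 φ x) (m : E) : 0 ≤ fderiv ℝ (fderiv ℝ φ) x m m := by
  by_contra! hneg
  have hline : ∀ t : ℝ, HasDerivAt (fun t : ℝ => x + t • m) m t := fun t => by
    simpa using ((hasDerivAt_id t).smul_const m).const_add x
  have htend : Tendsto (fun t : ℝ => x + t • m) (𝓝 0) (𝓝 x) := by
    have := (hline 0).continuousAt.tendsto
    simpa using this
  have hd1 : deriv (fun t : ℝ => φ (x + t • m)) =ᶠ[𝓝 0] fun t => fderiv ℝ φ (x + t • m) m := by
    have : ∀ᶠ y in 𝓝 x, DifferentiableAt ℝ φ y :=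
      (hφ.eventually (by norm_num)).mono fun y hy => hy.differentiableAt (by norm_num)
    filter_upwards [htend.eventually this] with t ht
    exact (ht.hasFDerivAt.comp_hasDerivAt t (hline t)).deriv
  have hd2 : HasDerivAt (fun t : ℝ => fderiv ℝ φ (x + t • m) m)
      (fderiv ℝ (fderiv ℝ φ) x m m) 0 := by
    have hF : HasFDerivAt (fderiv ℝ φ) (fderiv ℝ (fderiv ℝ φ) x) (x + (0:ℝ) • m) := by
      have : DifferentiableAt ℝ (fderiv ℝ φ) x :=
        (hφ.fderiv_right (m := 1) (by norm_num)).differentiableAt (by norm_num)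
      simpa using this.hasFDerivAt
    have h1 : HasDerivAt (fun t : ℝ => fderiv ℝ φ (x + t • m)) (fderiv ℝ (fderiv ℝ φ) x m) 0 :=
      hF.comp_hasDerivAt 0 (hline 0)
    simpa using h1.clm_apply (hasDerivAt_const (0:ℝ) m)
  have hdd : deriv (deriv fun t : ℝ => φ (x + t • m)) 0 = fderiv ℝ (fderiv ℝ φ) x m m := by
    rw [hd1.deriv_eq, hd2.deriv]
  have hmin : ∀ᶠ t in 𝓝 (0:ℝ), φ x ≤ φ (x + t • m) := htend.eventually h
  have hmax : IsLocalMax (fun t : ℝ => φ (x + t • m)) 0 := by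
    refine isLocalMax_of_deriv_deriv_neg (hdd ▸ hneg) ?_ ?_
    · rw [hd1.self_of_nhds]; simp [h.fderiv_eq_zero]
    · have : ContinuousAt φ (x + (0:ℝ) • m) := by simpa using hφ.continuousAt
      exact ContinuousAt.comp (f := fun t : ℝ => x + t • m) this (hline 0).continuousAt
  have hconst : (fun t : ℝ => φ (x + t • m)) =ᶠ[𝓝 0] fun _ => φ x := by
    filter_upwards [hmin, hmax] with t h1 h2
    simp only [zero_smul, add_zero] at h2
    exact le_antisymm h2 h1
  have : deriv (deriv fun t : ℝ => φ (x + t • m)) 0 = 0 := by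
    rw [(hconst.deriv).deriv_eq]; simp
  linarith

/-- A minimum principle. -/
theorem nonneg_of_forall_exists_fderiv_fderiv_neg [ProperSpace E] {U : Set E} (hU : IsOpen U)
    (hUb : Bornology.IsBounded U) {φ : E → ℝ} (hc : ContinuousOn φ (closure U))
    (hC : ContDiffOn ℝ 2 φ U) (hfr : ∀ x ∈ frontier U, 0 ≤ φ x)
    (hneg : ∀ x ∈ U, φ x < 0 → fderiv ℝ φ x = 0 → ∃ m, fderiv ℝ (fderiv ℝ φ) x m m < 0) :
    ∀ x ∈ U, 0 ≤ φ x := by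
  intro x hx
  obtain ⟨y, hy, hmin⟩ := hUb.isCompact_closure.exists_isMinOn ⟨x, subset_closure hx⟩ hc
  refine le_trans ?_ (hmin (subset_closure hx))
  by_contra! hlt
  have hyU : y ∈ U := by
    by_contra hn
    exact absurd (hfr y ⟨hy, by rwa [hU.interior_eq]⟩) (not_le.2 hlt)
  have hloc : IsLocalMin φ y :=
    (hmin.on_subset subset_closure).isLocalMin (hU.mem_nhds hyU)
  obtain ⟨m, hm⟩ := hneg y hyU hlt hloc.fderiv_eq_zero
  exact absurd (hloc.fderiv_fderiv_apply_self_nonneg (hC.contDiffAt (hU.mem_nhds hyU)) m)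
    (not_le.2 hm)

/-- A one-sided linear lower bound passes to the derivative. -/
theorem le_fderiv_of_eventually_le {u : E → ℝ} {p d : E} {κ : ℝ} (hu : DifferentiableAt ℝ u p)
    (h0 : u p = 0) (h : ∀ᶠ t in 𝓝[>] (0:ℝ), κ * t ≤ u (p + t • d)) : κ ≤ fderiv ℝ u p d := by
  have hline : HasDerivAt (fun t : ℝ => p + t • d) d 0 := by
    simpa using ((hasDerivAt_id (0:ℝ)).smul_const d).const_add p
  have hF : HasFDerivAt u (fderiv ℝ u p) (p + (0:ℝ) • d) := by simpa using hu.hasFDerivAt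
  have hg : HasDerivAt (fun t : ℝ => u (p + t • d)) (fderiv ℝ u p d) 0 :=
    hF.comp_hasDerivAt 0 hline
  have hs := hg.hasDerivWithinAt (s := Ioi 0)
  rw [hasDerivWithinAt_iff_tendsto_slope' (by simp)] at hs
  refine ge_of_tendsto hs ?_
  filter_upwards [h, self_mem_nhdsWithin] with t h1 (h2 : 0 < t)
  rw [slope_def_field]
  simp only [zero_smul, add_zero, h0, sub_zero]
  rwa [le_div_iff₀ h2]

end MinPrinciple

section Frame

open Topology Filter

/-- The plane with its Euclidean norm. -/
abbrev Plane := EuclideanSpace ℝ (Fin 2)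

namespace Plane

/-- Rotation by a right angle. -/
def rot (a : Plane) : Plane := !₂[-a 1, a 0]

theorem eq_coord (a : Plane) :
    a = a 0 • EuclideanSpace.single 0 (1:ℝ) + a 1 • EuclideanSpace.single 1 (1:ℝ) := by
  ext i; fin_cases i <;> simp

theorem rot_eq_coord (a : Plane) :
    rot a = (-a 1) • EuclideanSpace.single 0 (1:ℝ) + a 0 • EuclideanSpace.single 1 (1:ℝ) := by
  ext i; fin_cases i <;> simp [rot]

theorem norm_sq_eq (a : Plane) : ‖a‖ ^ 2 = a 0 ^ 2 + a 1 ^ 2 := by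
  rw [EuclideanSpace.norm_sq_eq]; simp

theorem sq_add_sq_of_norm_eq_one {a : Plane} (ha : ‖a‖ = 1) : a 0 ^ 2 + a 1 ^ 2 = 1 := by
  rw [← norm_sq_eq, ha, one_pow]

theorem inner_eq (a b : Plane) : inner ℝ a b = a 0 * b 0 + a 1 * b 1 := by
  simp [PiLp.inner_apply, mul_comm]

theorem inner_rot_self (a : Plane) : inner ℝ (rot a) a = 0 := by
  rw [inner_eq]; simp [rot]; ring

theorem inner_self_rot (a : Plane) : inner ℝ a (rot a) = 0 := by
  rw [inner_eq]; simp [rot]; ring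

theorem norm_rot (a : Plane) : ‖rot a‖ = ‖a‖ := by
  have : ‖rot a‖ ^ 2 = ‖a‖ ^ 2 := by simp [norm_sq_eq, rot]; ring
  exact (sq_eq_sq₀ (norm_nonneg _) (norm_nonneg _)).1 this

theorem eq_inner_smul_add {a : Plane} (ha : ‖a‖ = 1) (y : Plane) :
    y = inner ℝ a y • a + inner ℝ (rot a) y • rot a := by
  have h := sq_add_sq_of_norm_eq_one ha
  ext i
  fin_cases i
  · simp [inner_eq, rot]; linear_combination (-y 0) * h
  · simp [inner_eq, rot]; linear_combination (-y 1) * h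

theorem clm_ext_frame {F : Type*} [NormedAddCommGroup F] [NormedSpace ℝ F] {a : Plane}
    (ha : ‖a‖ = 1) {L M : Plane →L[ℝ] F} (h1 : L a = M a) (h2 : L (rot a) = M (rot a)) :
    L = M := by
  ext1 y
  rw [eq_inner_smul_add ha y]
  simp [h1, h2]

end Plane

open Plane

variable {u : Plane → ℝ} {x : Plane}

theorem gradient_apply_eq_fderiv (u : Plane → ℝ) (x : Plane) (i : Fin 2) :
    gradient u x i = fderiv ℝ u x (EuclideanSpace.single i 1) := by
  have : inner ℝ (gradient u x) (EuclideanSpace.single i (1:ℝ))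
      = fderiv ℝ u x (EuclideanSpace.single i 1) := by
    rw [gradient, InnerProductSpace.toDual_symm_apply]
  rw [← this, EuclideanSpace.inner_single_right]
  simp

theorem hessEntry_eq_fderiv (u : Plane → ℝ) (x : Plane) (i j : Fin 2) :
    hessEntry u x i j = fderiv ℝ (fderiv ℝ u) x (EuclideanSpace.single i 1)
      (EuclideanSpace.single j 1) := by
  rw [hessEntry, iteratedFDeriv_two_apply]; rfl

theorem ContDiffAt.fderiv_fderiv_symm (hu : ContDiffAt ℝ 2 u x) (w w' : Plane) :
    fderiv ℝ (fderiv ℝ u) x w w' = fderiv ℝ (fderiv ℝ u) x w' w :=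
  (hu.isSymmSndFDerivAt (by simp)).eq w w'

/-- The mean curvature equation in the orthonormal frame `(a, rot a)`. -/
theorem meanCurv_frame (hu : ContDiffAt ℝ 2 u x) {a : Plane} (ha : ‖a‖ = 1) :
    (1 + fderiv ℝ u x (rot a) ^ 2) * fderiv ℝ (fderiv ℝ u) x a a
      + (-2 * fderiv ℝ u x a * fderiv ℝ u x (rot a)) * fderiv ℝ (fderiv ℝ u) x a (rot a)
      + (1 + fderiv ℝ u x a ^ 2) * fderiv ℝ (fderiv ℝ u) x (rot a) (rot a)
    = √(1 + fderiv ℝ u x a ^ 2 + fderiv ℝ u x (rot a) ^ 2) ^ 3 * meanCurv u x := by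
  have h := sq_add_sq_of_norm_eq_one ha
  set e₀ : Plane := EuclideanSpace.single 0 1 with he₀
  set e₁ : Plane := EuclideanSpace.single 1 1 with he₁
  have hsymm := hu.fderiv_fderiv_symm e₁ e₀
  have hW : 1 + fderiv ℝ u x a ^ 2 + fderiv ℝ u x (rot a) ^ 2 = 1 + ‖gradient u x‖ ^ 2 := by
    rw [norm_sq_eq, gradient_apply_eq_fderiv, gradient_apply_eq_fderiv, rot_eq_coord,
      congrArg (fderiv ℝ u x) (eq_coord a)]
    simp only [map_add, map_smul, smul_eq_mul]
    linear_combination (fderiv ℝ u x e₀ ^ 2 + fderiv ℝ u x e₁ ^ 2) * h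
  have hWpos : 0 < 1 + ‖gradient u x‖ ^ 2 := by positivity
  have hm : √(1 + ‖gradient u x‖ ^ 2) ^ 3 * meanCurv u x
      = (1 + fderiv ℝ u x e₁ ^ 2) * fderiv ℝ (fderiv ℝ u) x e₀ e₀
        - 2 * fderiv ℝ u x e₀ * fderiv ℝ u x e₁ * fderiv ℝ (fderiv ℝ u) x e₀ e₁
        + (1 + fderiv ℝ u x e₀ ^ 2) * fderiv ℝ (fderiv ℝ u) x e₁ e₁ := by
    have hs : √(1 + ‖gradient u x‖ ^ 2) ^ 2 = 1 + ‖gradient u x‖ ^ 2 := Real.sq_sqrt hWpos.le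
    have hs0 : √(1 + ‖gradient u x‖ ^ 2) ≠ 0 := (Real.sqrt_pos.2 hWpos).ne'
    have hn : ‖gradient u x‖ ^ 2 = fderiv ℝ u x e₀ ^ 2 + fderiv ℝ u x e₁ ^ 2 := by
      rw [norm_sq_eq, gradient_apply_eq_fderiv, gradient_apply_eq_fderiv]
    simp only [meanCurv, mcCoeff, Fin.sum_univ_two, hessEntry_eq_fderiv,
      gradient_apply_eq_fderiv, ← he₀, ← he₁, hsymm]
    generalize √(1 + ‖gradient u x‖ ^ 2) = W at hs hs0 ⊢
    rw [← hs]
    simp only [Fin.isValue, if_true, zero_ne_one, one_ne_zero, if_false]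
    rw [hn] at hs
    field_simp
    rw [hs]
    ring
  rw [hW, hm, rot_eq_coord]
  have ea : ∀ (D : Plane →L[ℝ] ℝ), D a = a 0 * D e₀ + a 1 * D e₁ := fun D => by
    conv_lhs => rw [eq_coord a]
    simp [he₀, he₁]
  have ea2 : ∀ (D : Plane →L[ℝ] Plane →L[ℝ] ℝ) w, D a w = a 0 * D e₀ w + a 1 * D e₁ w :=
    fun D w => by
      conv_lhs => rw [eq_coord a]
      simp [he₀, he₁]
  simp only [map_add, map_smul, smul_eq_mul, add_apply, smul_apply, ea, ea2, ← he₀, ← he₁, hsymm]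
  generalize fderiv ℝ u x e₀ = g₀
  generalize fderiv ℝ u x e₁ = g₁
  generalize fderiv ℝ (fderiv ℝ u) x e₀ e₀ = h₀
  generalize fderiv ℝ (fderiv ℝ u) x e₀ e₁ = h₁
  generalize fderiv ℝ (fderiv ℝ u) x e₁ e₁ = h₂
  linear_combination ((h₀ + h₂) + (a 0 ^ 2 + a 1 ^ 2 + 1)
    * (g₁ ^ 2 * h₀ - 2 * g₀ * g₁ * h₁ + g₀ ^ 2 * h₂)) * h

end Frame

section Hopf

open Topology Filter Plane

/-- A positive solution of the Dirichlet problem for the mean curvature equation. -/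
structure IsPositiveSolution (Ω V : Set Plane) (f : ℝ → ℝ) (u : Plane → ℝ) : Prop where
  nonempty : Ω.Nonempty
  isOpen : IsOpen Ω
  isBounded : Bornology.IsBounded Ω
  analytic_rhs : AnalyticOnNhd ℝ f univ
  monotone_rhs : Monotone f
  eq : ∀ x ∈ Ω, meanCurv u x = f (u x)
  eq_zero : ∀ x ∈ frontier Ω, u x = 0
  pos : ∀ x ∈ Ω, 0 < u x
  analytic : AnalyticOnNhd ℝ u Ω
  isOpen_nhd : IsOpen V
  closure_subset : closure Ω ⊆ V
  contDiffOn : ContDiffOn ℝ 2 u V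

theorem exists_apply_self_neg {E : Type*} [NormedAddCommGroup E] [NormedSpace ℝ E]
    (D : E →L[ℝ] E →L[ℝ] ℝ) {a b : E} (hab : D b a = D a b) {p q : ℝ}
    (h : (1 + q ^ 2) * D a a + (-2 * p * q) * D a b + (1 + p ^ 2) * D b b < 0) :
    ∃ m, D m m < 0 := by
  by_contra! hD
  have h1 := hD a
  have h2 := hD b
  have h3 := hD (q • a - p • b)
  simp only [map_sub, map_smul, sub_apply, smul_apply, smul_eq_mul, hab] at h3
  nlinarith

theorem IsOpen.subset_of_isPreconnected_of_disjoint_frontier {X : Type*} [TopologicalSpace X]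
    {Ω s : Set X} (hΩ : IsOpen Ω) (hs : IsPreconnected s) (hne : (s ∩ Ω).Nonempty)
    (hd : Disjoint s (frontier Ω)) : s ⊆ Ω := by
  refine hs.subset_left_of_subset_union hΩ isClosed_closure.isOpen_compl
    (disjoint_compl_right.mono_left subset_closure) (fun x hx => ?_) hne
  by_cases hxΩ : x ∈ Ω
  · exact Or.inl hxΩ
  · exact Or.inr fun hxc => Set.disjoint_left.1 hd hx ⟨hxc, by rwa [hΩ.interior_eq]⟩

section Calculus

variable {E : Type*} [NormedAddCommGroup E] [NormedSpace ℝ E]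

theorem fderiv_comp_real {ψ ψ' : ℝ → ℝ} (hψ : ∀ s, HasDerivAt ψ (ψ' s) s) {g : E → ℝ}
    (hg : ContDiff ℝ 2 g) (x : E) :
    fderiv ℝ (fun y => ψ (g y)) x = ψ' (g x) • fderiv ℝ g x :=
  ((hψ (g x)).comp_hasFDerivAt x ((hg.differentiable (by norm_num)) x).hasFDerivAt).fderiv

theorem fderiv_fderiv_comp_real {ψ ψ' ψ'' : ℝ → ℝ} (hψ : ∀ s, HasDerivAt ψ (ψ' s) s)
    (hψ' : ∀ s, HasDerivAt ψ' (ψ'' s) s) {g : E → ℝ} (hg : ContDiff ℝ 2 g) (x w w' : E) :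
    fderiv ℝ (fderiv ℝ (fun y => ψ (g y))) x w w'
      = ψ'' (g x) * (fderiv ℝ g x w * fderiv ℝ g x w')
        + ψ' (g x) * fderiv ℝ (fderiv ℝ g) x w w' := by
  have h1 : fderiv ℝ (fun y => ψ (g y)) = fun y => ψ' (g y) • fderiv ℝ g y :=
    funext (fderiv_comp_real hψ hg)
  have hg1 : ContDiff ℝ 1 (fderiv ℝ g) := hg.fderiv_right (by norm_num)
  have h2 := (((hψ' (g x)).comp_hasFDerivAt x
    ((hg.differentiable (by norm_num)) x).hasFDerivAt).smul
    ((hg1.differentiable (by norm_num)) x).hasFDerivAt)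
  rw [h1]
  have h3 := congrArg (fun L : E →L[ℝ] E →L[ℝ] ℝ => L w w') h2.fderiv
  refine Eq.trans h3 ?_
  simp
  ring

theorem fderiv_sub_const_mul {u w : E → ℝ} {x : E} (hu : DifferentiableAt ℝ u x)
    (hw : ContDiff ℝ 2 w) (ε : ℝ) :
    fderiv ℝ (fun y => u y - ε * w y) x = fderiv ℝ u x - ε • fderiv ℝ w x :=
  (hu.hasFDerivAt.sub (((hw.differentiable (by norm_num)) x).hasFDerivAt.const_mul ε)).fderiv

theorem fderiv_fderiv_sub_const_mul {u w : E → ℝ} {x : E} (hu : ContDiffAt ℝ 2 u x)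
    (hw : ContDiff ℝ 2 w) (ε : ℝ) (a b : E) :
    fderiv ℝ (fderiv ℝ (fun y => u y - ε * w y)) x a b
      = fderiv ℝ (fderiv ℝ u) x a b - ε * fderiv ℝ (fderiv ℝ w) x a b := by
  have h1 : fderiv ℝ (fun y => u y - ε * w y) =ᶠ[𝓝 x]
      fun y => fderiv ℝ u y - ε • fderiv ℝ w y := by
    filter_upwards [hu.eventually (by norm_num)] with y hy
    exact fderiv_sub_const_mul (hy.differentiableAt (by norm_num)) hw ε
  have hw1 : ContDiff ℝ 1 (fderiv ℝ w) := hw.fderiv_right (by norm_num)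
  have hu1 : DifferentiableAt ℝ (fderiv ℝ u) x :=
    (hu.fderiv_right (m := 1) (by norm_num)).differentiableAt (by norm_num)
  rw [h1.fderiv_eq]
  have h2 : HasFDerivAt (fun y => fderiv ℝ u y - ε • fderiv ℝ w y) _ x := hu1.hasFDerivAt.sub
    (((hw1.differentiable (by norm_num)) x).hasFDerivAt.const_smul ε)
  rw [h2.fderiv]
  simp

end Calculus

theorem contDiff_sub_norm_sq (R : ℝ) (c : Plane) :
    ContDiff ℝ 2 fun y : Plane => R - ‖y - c‖ ^ 2 :=
  contDiff_const.sub ((contDiff_norm_sq ℝ).comp (contDiff_id.sub contDiff_const))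

theorem fderiv_sub_norm_sq (R : ℝ) (c x w : Plane) :
    fderiv ℝ (fun y : Plane => R - ‖y - c‖ ^ 2) x w = -2 * inner ℝ (x - c) w := by
  have h := (((hasStrictFDerivAt_norm_sq (x - c)).hasFDerivAt.comp x
    ((hasFDerivAt_id x).sub_const c)).const_sub R).fderiv
  have h3 := congrArg (fun L : Plane →L[ℝ] ℝ => L w) h
  refine Eq.trans h3 ?_
  simp [inner_sub_left]

theorem fderiv_fderiv_sub_norm_sq (R : ℝ) (c x w w' : Plane) :
    fderiv ℝ (fderiv ℝ fun y : Plane => R - ‖y - c‖ ^ 2) x w w' = -2 * inner ℝ w w' := by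
  have h1 : (fderiv ℝ fun y : Plane => R - ‖y - c‖ ^ 2)
      = fun y => (-2 : ℝ) • innerSL ℝ (y - c) := by
    ext y w
    rw [fderiv_sub_norm_sq]; simp [inner_sub_left]
  have h2 : HasFDerivAt (fun y : Plane => (-2 : ℝ) • innerSL ℝ (y - c)) _ x :=
    (((innerSL ℝ).hasFDerivAt).comp x ((hasFDerivAt_id x).sub_const c)).const_smul (-2 : ℝ)
  rw [h1, h2.fderiv]
  simp only [smul_apply, ContinuousLinearMap.comp_apply, ContinuousLinearMap.id_apply, smul_eq_mul]
  rw [innerSL_apply_apply]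

theorem barrier_ineq {k s r G P Q A B : ℝ} (hk : 0 < k) (hs : 0 < s) (hks : k * s ≤ 1)
    (hG : P ^ 2 + Q ^ 2 ≤ G) (hkr : k * r ^ 2 = 2 * (2 + G))
    (hAB : 3 / 4 * r ^ 2 ≤ A ^ 2 + B ^ 2) :
    0 < (1 + Q ^ 2) * (8 * k * (A * A) - 2 * (1 + 2 * k * s) * 1 ^ 2)
      + (-2 * P * Q) * (8 * k * (A * B) - 2 * (1 + 2 * k * s) * 0)
      + (1 + P ^ 2) * (8 * k * (B * B) - 2 * (1 + 2 * k * s) * 1 ^ 2) := by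
  have i0 : 0 < k * s := by positivity
  have i1 : 2 * (1 + 2 * k * s) * (2 + P ^ 2 + Q ^ 2) ≤ 6 * (2 + G) := by
    nlinarith [sq_nonneg P, sq_nonneg Q]
  have i2 : 8 * k * (A ^ 2 + B ^ 2) ≥ 12 * (2 + G) := by nlinarith
  have i3 : 0 ≤ 8 * k * (Q * A - P * B) ^ 2 := by positivity
  have i4 : (1 + Q ^ 2) * (8 * k * (A * A) - 2 * (1 + 2 * k * s) * 1 ^ 2)
      + (-2 * P * Q) * (8 * k * (A * B) - 2 * (1 + 2 * k * s) * 0)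
      + (1 + P ^ 2) * (8 * k * (B * B) - 2 * (1 + 2 * k * s) * 1 ^ 2)
      = 8 * k * (A ^ 2 + B ^ 2) + 8 * k * (Q * A - P * B) ^ 2
        - 2 * (1 + 2 * k * s) * (2 + P ^ 2 + Q ^ 2) := by ring
  rw [i4]
  nlinarith [sq_nonneg P, sq_nonneg Q]

namespace IsPositiveSolution

variable {Ω V : Set Plane} {f : ℝ → ℝ} {u : Plane → ℝ}

theorem contDiffAt (h : IsPositiveSolution Ω V f u) {x : Plane} (hx : x ∈ closure Ω) :
    ContDiffAt ℝ 2 u x :=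
  h.contDiffOn.contDiffAt (h.isOpen_nhd.mem_nhds (h.closure_subset hx))

theorem continuousOn (h : IsPositiveSolution Ω V f u) : ContinuousOn u (closure Ω) :=
  h.contDiffOn.continuousOn.mono h.closure_subset

theorem continuousOn_fderiv (h : IsPositiveSolution Ω V f u) :
    ContinuousOn (fderiv ℝ u) (closure Ω) :=
  (h.contDiffOn.continuousOn_fderiv_of_isOpen h.isOpen_nhd (by norm_num)).mono h.closure_subset

theorem continuousOn_fderiv_fderiv (h : IsPositiveSolution Ω V f u) :
    ContinuousOn (fderiv ℝ (fderiv ℝ u)) (closure Ω) :=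
  ((h.contDiffOn.fderiv_of_isOpen h.isOpen_nhd (m := 1) (by norm_num)).continuousOn_fderiv_of_isOpen
    h.isOpen_nhd (by norm_num)).mono h.closure_subset

theorem isCompact_closure (h : IsPositiveSolution Ω V f u) : IsCompact (closure Ω) :=
  h.isBounded.isCompact_closure

theorem mem_frontier (h : IsPositiveSolution Ω V f u) {x : Plane} (hx : x ∈ closure Ω)
    (hn : x ∉ Ω) : x ∈ frontier Ω :=
  ⟨hx, by rwa [h.isOpen.interior_eq]⟩

theorem nonneg (h : IsPositiveSolution Ω V f u) {x : Plane} (hx : x ∈ closure Ω) : 0 ≤ u x := by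
  by_cases hn : x ∈ Ω
  · exact (h.pos x hn).le
  · exact (h.eq_zero x (h.mem_frontier hx hn)).ge

theorem frame_eq (h : IsPositiveSolution Ω V f u) {x : Plane} (hx : x ∈ Ω) {a : Plane}
    (ha : ‖a‖ = 1) :
    (1 + fderiv ℝ u x (rot a) ^ 2) * fderiv ℝ (fderiv ℝ u) x a a
      + (-2 * fderiv ℝ u x a * fderiv ℝ u x (rot a)) * fderiv ℝ (fderiv ℝ u) x a (rot a)
      + (1 + fderiv ℝ u x a ^ 2) * fderiv ℝ (fderiv ℝ u) x (rot a) (rot a)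
    = √(1 + fderiv ℝ u x a ^ 2 + fderiv ℝ u x (rot a) ^ 2) ^ 3 * f (u x) := by
  rw [meanCurv_frame (h.contDiffAt (subset_closure hx)) ha, h.eq x hx]

theorem rhs_nonpos (h : IsPositiveSolution Ω V f u) {x : Plane} (hx : x ∈ Ω) : f (u x) ≤ 0 := by
  obtain ⟨y, hy, hmax⟩ :=
    h.isCompact_closure.exists_isMaxOn ⟨x, subset_closure hx⟩ h.continuousOn
  refine (h.monotone_rhs (hmax (subset_closure hx))).trans ?_
  have hyΩ : y ∈ Ω := by
    by_contra hn
    have h1 := h.eq_zero y (h.mem_frontier hy hn)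
    have h2 : u x ≤ u y := hmax (subset_closure hx)
    have h3 := h.pos x hx
    linarith
  have hloc : IsLocalMin (fun z => -u z) y :=
    ((hmax.on_subset subset_closure).isLocalMax (h.isOpen.mem_nhds hyΩ)).neg
  have hD : ∀ m, fderiv ℝ (fderiv ℝ u) y m m ≤ 0 := fun m => by
    have h1 := hloc.fderiv_fderiv_apply_self_nonneg (h.contDiffAt hy).neg m
    have h2 : (fderiv ℝ fun z => -u z) = fun z => -fderiv ℝ u z := funext fun z => fderiv_fun_neg
    rw [h2, fderiv_fun_neg] at h1
    simpa using h1
  have ha : ‖(EuclideanSpace.single 0 1 : Plane)‖ = 1 := by simp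
  have he := h.frame_eq hyΩ ha
  have hg : fderiv ℝ u y = 0 := by
    have := hloc.neg.fderiv_eq_zero
    simpa using this
  simp only [hg, zero_apply] at he
  norm_num at he
  rw [← he]
  exact add_nonpos (hD _) (hD _)

set_option maxHeartbeats 800000 in
/-- Hopf's lemma. -/
theorem fderiv_ne_zero_of_ball_subset (h : IsPositiveSolution Ω V f u) {c p : Plane} {r : ℝ}
    (hr : 0 < r) (hball : ball c r ⊆ Ω) (hp : p ∈ frontier Ω) (hpc : ‖p - c‖ = r) :
    fderiv ℝ u p ≠ 0 := by
  set a : Plane := EuclideanSpace.single 0 1 with ha'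
  have ha : ‖a‖ = 1 := by simp [ha']
  obtain ⟨G, hG⟩ := h.isCompact_closure.bddAbove_image
    (f := fun x => fderiv ℝ u x a ^ 2 + fderiv ℝ u x (rot a) ^ 2)
    (((h.continuousOn_fderiv.clm_apply continuousOn_const).pow 2).add
      ((h.continuousOn_fderiv.clm_apply continuousOn_const).pow 2))
  replace hG : ∀ x ∈ closure Ω, fderiv ℝ u x a ^ 2 + fderiv ℝ u x (rot a) ^ 2 ≤ G :=
    fun x hx => hG ⟨x, hx, rfl⟩
  have hG0 : 0 ≤ G := (by positivity : (0:ℝ) ≤ _).trans (hG p hp.1)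
  set s₀ : ℝ := r ^ 2 / (2 * (2 + G)) with hs₀
  set k : ℝ := 2 * (2 + G) / r ^ 2 with hk
  have hs₀pos : 0 < s₀ := by positivity
  have hkpos : 0 < k := by positivity
  have hks : k * s₀ = 1 := by rw [hk, hs₀]; field_simp
  have hkr : k * r ^ 2 = 2 * (2 + G) := by rw [hk]; field_simp
  have hs₀r : s₀ ≤ r ^ 2 / 4 := by
    rw [hs₀]; gcongr; linarith
  set g : Plane → ℝ := fun y => r ^ 2 - ‖y - c‖ ^ 2 with hg
  have hgC : ContDiff ℝ 2 g := contDiff_sub_norm_sq _ _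
  set ψ : ℝ → ℝ := fun s => s + k * s ^ 2 with hψ
  have hψ1 : ∀ s, HasDerivAt ψ (1 + 2 * k * s) s := fun s =>
    ((hasDerivAt_id s).add ((hasDerivAt_pow 2 s).const_mul k)).congr_deriv (by simp; ring)
  have hψ2 : ∀ s, HasDerivAt (fun s : ℝ => 1 + 2 * k * s) (2 * k) s := fun s => by
    simpa using ((hasDerivAt_id s).const_mul (2 * k)).const_add 1
  set w : Plane → ℝ := fun y => ψ (g y) with hw
  have hwC : ContDiff ℝ 2 w := hgC.add (contDiff_const.mul (hgC.pow 2))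
  have hw2 : ∀ x d d', fderiv ℝ (fderiv ℝ w) x d d'
      = 8 * k * (inner ℝ (x - c) d * inner ℝ (x - c) d')
        - 2 * (1 + 2 * k * g x) * inner ℝ d d' := fun x d d' => by
    rw [hw, fderiv_fderiv_comp_real hψ1 hψ2 hgC]
    simp only [hg, fderiv_sub_norm_sq, fderiv_fderiv_sub_norm_sq]
    ring
  have hgpos : ∀ y, 0 < g y → y ∈ Ω := fun y hy => hball (by
    rw [mem_ball_iff_norm]
    exact lt_of_pow_lt_pow_left₀ 2 hr.le (by simpa [hg] using hy))
  set Z : Set Plane := {y | s₀ ≤ g y} with hZ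
  have hZΩ : Z ⊆ Ω := fun y hy => hgpos y (hs₀pos.trans_le hy)
  have hZc : IsCompact Z := Metric.isCompact_of_isClosed_isBounded
    (isClosed_le continuous_const hgC.continuous) (h.isBounded.subset hZΩ)
  obtain ⟨z, hzZ, hzmin⟩ := hZc.exists_isMinOn
    ⟨c, by simp only [hZ, hg, mem_ofPred_eq, sub_self, norm_zero]; nlinarith [sq_nonneg r]⟩
    (h.continuousOn.mono (hZΩ.trans subset_closure))
  have hm : 0 < u z := h.pos z (hZΩ hzZ)
  have hψ₀ : 0 < ψ s₀ := by simp only [hψ]; positivity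
  set ε : ℝ := u z / ψ s₀ with hε
  have hεpos : 0 < ε := div_pos hm hψ₀
  set U : Set Plane := {y | 0 < g y ∧ g y < s₀} with hU
  have hUo : IsOpen U := (isOpen_lt continuous_const hgC.continuous).inter
    (isOpen_lt hgC.continuous continuous_const)
  have hUΩ : U ⊆ Ω := fun y hy => hgpos y hy.1
  have hUcl : closure U ⊆ {y | 0 ≤ g y ∧ g y ≤ s₀} :=
    closure_minimal (fun y hy => ⟨hy.1.le, hy.2.le⟩)
      ((isClosed_le continuous_const hgC.continuous).inter
        (isClosed_le hgC.continuous continuous_const))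
  have hcmp : ∀ x ∈ U, 0 ≤ u x - ε * w x := by
    refine nonneg_of_forall_exists_fderiv_fderiv_neg hUo (h.isBounded.subset hUΩ)
      ((h.continuousOn.mono (closure_mono hUΩ)).sub
        (continuousOn_const.mul hwC.continuous.continuousOn))
      (fun x hx => (((h.contDiffAt (subset_closure (hUΩ hx))).sub
        (contDiffAt_const.mul hwC.contDiffAt)).contDiffWithinAt)) ?_ ?_
    · intro x hx
      have hxc := hUcl hx.1
      have hxU : x ∉ U := by have := hx.2; rwa [hUo.interior_eq] at this
      rcases hxc.1.eq_or_lt with h0 | h0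
      · simp only [hw, hψ, ← h0]
        simpa using h.nonneg (closure_mono hUΩ hx.1)
      · have h1 : g x = s₀ := le_antisymm hxc.2 (not_lt.1 fun hlt => hxU ⟨h0, hlt⟩)
        simp only [hw, h1]
        rw [hε, div_mul_cancel₀ _ hψ₀.ne', sub_nonneg]
        exact hzmin (show s₀ ≤ g x from h1.ge)
    · intro x hx _ _
      have hxΩ := hUΩ hx
      have hcd := h.contDiffAt (subset_closure hxΩ)
      refine exists_apply_self_neg _ (a := a) (b := rot a) (p := fderiv ℝ u x a)
        (q := fderiv ℝ u x (rot a)) ?_ ?_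
      · simp only [fderiv_fderiv_sub_const_mul hcd hwC]
        rw [hcd.fderiv_fderiv_symm, hwC.contDiffAt.fderiv_fderiv_symm]
      · have e1 := h.frame_eq hxΩ ha
        have e2 := mul_nonpos_of_nonneg_of_nonpos (pow_nonneg (Real.sqrt_nonneg
          (1 + fderiv ℝ u x a ^ 2 + fderiv ℝ u x (rot a) ^ 2)) 3) (h.rhs_nonpos hxΩ)
        have hn : ‖x - c‖ ^ 2 = inner ℝ (x - c) a ^ 2 + inner ℝ (x - c) (rot a) ^ 2 := by
          rw [norm_sq_eq]; simp [inner_eq, rot, ha']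
        have hgx : g x = r ^ 2 - ‖x - c‖ ^ 2 := rfl
        have hg1 := hx.1
        have hg2 := hx.2
        have hGx := hG x (subset_closure hxΩ)
        simp only [fderiv_fderiv_sub_const_mul hcd hwC, hw2, inner_self_rot,
          real_inner_self_eq_norm_sq, norm_rot, ha]
        generalize fderiv ℝ u x a = P at *
        generalize fderiv ℝ u x (rot a) = Q at *
        generalize inner ℝ (x - c) a = A at *
        generalize inner ℝ (x - c) (rot a) = B at *
        have hεk := mul_pos hεpos (barrier_ineq (P := P) (Q := Q) (A := A) (B := B) (s := g x)
          hkpos hg1 (hks ▸ by gcongr) hGx hkr (by linarith))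
        linarith
  have hd : ε * r ^ 2 ≤ fderiv ℝ u p (c - p) := by
    refine le_fderiv_of_eventually_le ((h.contDiffAt hp.1).differentiableAt (by norm_num))
      (h.eq_zero p hp) ?_
    have hev : ∀ᶠ t in 𝓝[>] (0:ℝ), t < min 1 (s₀ / (2 * r ^ 2)) :=
      nhdsWithin_le_nhds (eventually_lt_nhds (by positivity))
    filter_upwards [hev, self_mem_nhdsWithin] with t ht (ht0 : 0 < t)
    have ht1 : t < 1 := ht.trans_le (min_le_left _ _)
    have ht2 : t * (2 * r ^ 2) < s₀ := by
      rw [← lt_div_iff₀ (by positivity)]; exact ht.trans_le (min_le_right _ _)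
    have hgt : g (p + t • (c - p)) = r ^ 2 * (2 * t - t ^ 2) := by
      have : p + t • (c - p) - c = (1 - t) • (p - c) := by module
      simp only [hg, this, norm_smul, hpc, Real.norm_eq_abs, mul_pow, sq_abs]
      ring
    have hr2 : 0 < r ^ 2 := by positivity
    have hU' : p + t • (c - p) ∈ U := by
      refine ⟨?_, ?_⟩ <;> rw [hgt]
      · exact mul_pos hr2 (by nlinarith)
      · nlinarith [mul_pos hr2 (pow_pos ht0 2)]
    have h1 := hcmp _ hU'
    have h2 : r ^ 2 * t ≤ w (p + t • (c - p)) := by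
      simp only [hw, hψ, hgt]
      have : 0 ≤ k * (r ^ 2 * (2 * t - t ^ 2)) ^ 2 := by positivity
      nlinarith
    nlinarith
  intro h0
  rw [h0, zero_apply] at hd
  have : 0 < ε * r ^ 2 := by positivity
  linarith

end IsPositiveSolution
end Hopf

section InteriorBall

open Topology Filter Asymptotics Plane

theorem exists_eventually_le_mul_sq {E : Type*} [NormedAddCommGroup E] [InnerProductSpace ℝ E]
    {γ : ℝ → E} (hγ : ContDiff ℝ 2 γ) {n : E} {p : E}
    (hn : ∀ t, 0 ≤ inner ℝ n (γ t - p)) {t₁ : ℝ} (ht : deriv γ t₁ ≠ 0) :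
    ∃ A : ℝ, ∀ᶠ t in 𝓝 t₁, inner ℝ n (γ t - p) ≤ A * ‖γ t - p‖ ^ 2 := by
  set g : ℝ → ℝ := fun t => inner ℝ n (γ t - p) with hg
  have hgC : ContDiff ℝ 2 g := contDiff_const.inner ℝ (hγ.sub contDiff_const)
  by_cases hp : γ t₁ = p
  · have hmin : IsLocalMin g t₁ := Eventually.of_forall fun t => by
      simpa [hg, hp] using hn t
    have hg0 : g t₁ = 0 := by simp [hg, hp]
    have hd0 : deriv g t₁ = 0 := hmin.deriv_eq_zero
    have hdiff : DifferentiableAt ℝ (deriv g) t₁ :=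
      ((hgC.iterate_deriv' 1 1).differentiable (by norm_num)).differentiableAt
    obtain ⟨M, hM0, hM⟩ := hdiff.isBigO_sub.exists_pos
    have hrev := (hγ.differentiable (by norm_num) t₁).hasDerivAt.isTheta_sub ht
    obtain ⟨C, hC0, hC⟩ := hrev.2.exists_pos
    have hC' := hC.bound
    obtain ⟨ρ, hρ, hMρ⟩ := Metric.eventually_nhds_iff.1 hM.bound
    refine ⟨M * C ^ 2, ?_⟩
    have hC'' : ∀ᶠ t in 𝓝 t₁, ‖t - t₁‖ ≤ C * ‖γ t - γ t₁‖ := by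
      simpa using hC'
    filter_upwards [hC'', Metric.ball_mem_nhds t₁ hρ] with t hCt htρ
    have hmv := (convex_closedBall t₁ ‖t - t₁‖).norm_image_sub_le_of_norm_deriv_le (𝕜 := ℝ)
      (f := g) (C := M * ‖t - t₁‖) (x := t₁) (y := t)
      (fun x _ => hgC.differentiable (by norm_num) x) (fun x hx => by
        have hx' : ‖x - t₁‖ ≤ ‖t - t₁‖ := by rwa [mem_closedBall_iff_norm] at hx
        have h1 := hMρ (y := x) (by
          rw [dist_eq_norm]; rw [mem_ball_iff_norm] at htρ; exact hx'.trans_lt htρ)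
        rw [hd0, sub_zero] at h1
        exact h1.trans (by gcongr)) (by simp)
        (by rw [mem_closedBall_iff_norm])
    rw [hg0, sub_zero] at hmv
    calc g t ≤ ‖g t‖ := Real.le_norm_self _
      _ ≤ M * ‖t - t₁‖ * ‖t - t₁‖ := hmv
      _ = M * ‖t - t₁‖ ^ 2 := by ring
      _ ≤ M * (C * ‖γ t - p‖) ^ 2 := by rw [hp] at hCt; gcongr
      _ = M * C ^ 2 * ‖γ t - p‖ ^ 2 := by ring
  · have hpos : 0 < ‖γ t₁ - p‖ ^ 2 := by
      have := norm_pos_iff.2 (sub_ne_zero.2 hp); positivity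
    refine ⟨g t₁ / ‖γ t₁ - p‖ ^ 2 + 1, ?_⟩
    have hc : ContinuousAt (fun t => (g t₁ / ‖γ t₁ - p‖ ^ 2 + 1) * ‖γ t - p‖ ^ 2 - g t) t₁ :=
      (((continuous_const.mul ((hγ.continuous.sub continuous_const).norm.pow 2)).sub
        hgC.continuous)).continuousAt
    have h0 : 0 < (g t₁ / ‖γ t₁ - p‖ ^ 2 + 1) * ‖γ t₁ - p‖ ^ 2 - g t₁ := by
      rw [add_mul, div_mul_cancel₀ _ hpos.ne']; linarith
    filter_upwards [hc.eventually (lt_mem_nhds h0)] with t ht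
    have := ht.le
    simp only [hg] at this ⊢
    linarith

/-- A convex open set whose boundary is a regular closed `C²` curve satisfies an interior ball
condition. -/
theorem exists_interior_ball {E : Type*} [NormedAddCommGroup E] [InnerProductSpace ℝ E]
    [CompleteSpace E]
    {Ω : Set E} (hΩ : IsOpen Ω) (hconv : Convex ℝ Ω) (hne : Ω.Nonempty)
    {γ : ℝ → E} (hγ : ContDiff ℝ 2 γ) {T : ℝ} (hT : 0 < T) (hper : Function.Periodic γ T)
    (hrange : range γ = frontier Ω) (hreg : ∀ t, deriv γ t ≠ 0) {p : E} (hp : p ∈ frontier Ω) :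
    ∃ n : E, n ≠ 0 ∧ ball (p + (2⁻¹ : ℝ) • n) (2⁻¹ * ‖n‖) ⊆ Ω := by
  have hpΩ : p ∉ Ω := fun h => hp.2 (by rwa [hΩ.interior_eq])
  obtain ⟨l, hl⟩ := geometric_hahn_banach_open_point hconv hΩ hpΩ
  set n₀ : E := -(InnerProductSpace.toDual ℝ E).symm l with hn₀
  have hin : ∀ y, inner ℝ n₀ y = -l y := fun y => by
    rw [hn₀, inner_neg_left, InnerProductSpace.toDual_symm_apply]
  have hpos : ∀ y ∈ Ω, 0 < inner ℝ n₀ (y - p) := fun y hy => by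
    rw [hin, map_sub]; linarith [hl y hy]
  have hnonneg : ∀ y ∈ closure Ω, 0 ≤ inner ℝ n₀ (y - p) := fun y hy =>
    closure_minimal (t := {y | 0 ≤ inner ℝ n₀ (y - p)}) (fun y hy => (hpos y hy).le)
      (isClosed_le continuous_const (by fun_prop)) hy
  have hγcl : ∀ t, γ t ∈ closure Ω := fun t => frontier_subset_closure (hrange ▸ mem_range_self t)
  obtain ⟨A, hA⟩ : ∃ A : ℝ, ∀ t ∈ Icc 0 (0 + T), inner ℝ n₀ (γ t - p) ≤ A * ‖γ t - p‖ ^ 2 := by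
    refine isCompact_Icc.induction_on (p := fun s : Set ℝ => ∃ A : ℝ, ∀ t ∈ s,
      inner ℝ n₀ (γ t - p) ≤ A * ‖γ t - p‖ ^ 2) ⟨0, by simp⟩ ?_ ?_ ?_
    · rintro s t hst ⟨A, hA⟩
      exact ⟨A, fun x hx => hA x (hst hx)⟩
    · rintro s t ⟨A, hA⟩ ⟨B, hB⟩
      refine ⟨max A B, ?_⟩
      rintro x (hx | hx)
      · exact (hA x hx).trans (by gcongr; exact le_max_left _ _)
      · exact (hB x hx).trans (by gcongr; exact le_max_right _ _)
    · intro t₁ _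
      obtain ⟨A, hA⟩ := exists_eventually_le_mul_sq hγ (fun t => hnonneg _ (hγcl t)) (hreg t₁)
      exact ⟨_, mem_nhdsWithin_of_mem_nhds hA, A, fun t ht => ht⟩
  set A' := max A 1 with hA'
  have hA'pos : 0 < A' := lt_max_of_lt_right one_pos
  set n : E := A'⁻¹ • n₀ with hn
  have hball : ∀ y, y ∈ ball (p + (2⁻¹ : ℝ) • n) (2⁻¹ * ‖n‖)
      ↔ ‖y - p‖ ^ 2 < inner ℝ n (y - p) := fun y => by
    rw [mem_ball_iff_norm, ← pow_lt_pow_iff_left₀ (norm_nonneg _) (by positivity) two_ne_zero,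
      ← sub_sub, norm_sub_sq_real, inner_smul_right, real_inner_comm, norm_smul, mul_pow, mul_pow]
    norm_num
    constructor <;> intro h <;> linarith
  obtain ⟨x₀, hx₀⟩ := hne
  have hnx₀ : 0 < inner ℝ n (x₀ - p) := by
    rw [hn, real_inner_smul_left]; exact mul_pos (inv_pos.2 hA'pos) (hpos x₀ hx₀)
  refine ⟨n, fun h => by simp [h] at hnx₀,
    hΩ.subset_of_isPreconnected_of_disjoint_frontier (convex_ball _ _).isPreconnected ?_ ?_⟩
  · set s : ℝ := min 1 (inner ℝ n (x₀ - p) / (2 * (‖x₀ - p‖ ^ 2 + 1))) with hs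
    have hs0 : 0 < s := by positivity
    refine ⟨p + s • (x₀ - p), (hball _).2 ?_, ?_⟩
    · rw [add_sub_cancel_left, norm_smul, inner_smul_right, mul_pow, Real.norm_eq_abs, sq_abs, sq,
        mul_assoc]
      refine mul_lt_mul_of_pos_left ?_ hs0
      have h1 : s * (2 * (‖x₀ - p‖ ^ 2 + 1)) ≤ inner ℝ n (x₀ - p) := by
        rw [← le_div_iff₀ (by positivity)]; exact min_le_right _ _
      have : 0 ≤ s * ‖x₀ - p‖ ^ 2 := by positivity
      linarith
    · have := hconv.add_smul_sub_mem_interior' hp.1 (by rwa [hΩ.interior_eq])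
        ⟨hs0, min_le_left 1 _⟩
      rwa [hΩ.interior_eq] at this
  · refine Set.disjoint_left.2 fun y hy hyf => ?_
    rw [hball, hn, real_inner_smul_left, ← div_eq_inv_mul, lt_div_iff₀ hA'pos] at hy
    rw [← hrange] at hyf
    obtain ⟨t, ht, rfl⟩ : y ∈ γ '' Icc 0 (0 + T) := by
      rwa [hper.image_Icc hT]
    have h1 := hA t ht
    have h2 : A * ‖γ t - p‖ ^ 2 ≤ A' * ‖γ t - p‖ ^ 2 := by gcongr; exact le_max_left _ _
    linarith

theorem exists_add_smul_mem_ball {E : Type*} [NormedAddCommGroup E] [InnerProductSpace ℝ E]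
    {n d : E} (p : E) (h : 0 < inner ℝ n d) :
    ∃ t > (0:ℝ), p + t • d ∈ ball (p + (2⁻¹ : ℝ) • n) (2⁻¹ * ‖n‖) := by
  have hd : 0 < ‖d‖ := norm_pos_iff.2 fun h0 => by simp [h0] at h
  refine ⟨inner ℝ n d / (2 * ‖d‖ ^ 2), by positivity, ?_⟩
  rw [mem_ball_iff_norm, ← pow_lt_pow_iff_left₀ (norm_nonneg _) (by positivity) two_ne_zero,
    add_sub_add_left_eq_sub, norm_sub_sq_real, inner_smul_right, real_inner_smul_left,
    real_inner_comm n d, norm_smul, norm_smul, Real.norm_eq_abs, mul_pow, mul_pow, mul_pow, sq_abs]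
  have : (inner ℝ n d / (2 * ‖d‖ ^ 2)) ^ 2 * ‖d‖ ^ 2
      = inner ℝ n d / (2 * ‖d‖ ^ 2) * (inner ℝ n d / 2) := by field_simp
  have h2 : 0 < inner ℝ n d / (2 * ‖d‖ ^ 2) * (inner ℝ n d / 2) := by positivity
  rw [this]
  norm_num
  linarith

namespace IsPositiveSolution

variable {Ω V : Set Plane} {f : ℝ → ℝ} {u : Plane → ℝ}

theorem interior_closure (h : IsPositiveSolution Ω V f u) : interior (closure Ω) = Ω := by
  refine Subset.antisymm (fun p hp => ?_) (interior_maximal subset_closure h.isOpen)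
  by_contra hpn
  have hpf := h.mem_frontier (interior_subset hp) hpn
  obtain ⟨ρ, hρ, hball⟩ := Metric.isOpen_iff.1 isOpen_interior p hp
  obtain ⟨y, hy, hyp⟩ := Metric.mem_closure_iff.1 hpf.1 (ρ / 2) (by positivity)
  obtain ⟨q, hq, hqd⟩ := isClosed_frontier.exists_infDist_eq_dist ⟨p, hpf⟩ y
  have hle : infDist y (frontier Ω) ≤ dist y p := infDist_le_dist_of_mem hpf
  have hr : 0 < dist y q := dist_pos.2 fun heq => by
    rw [← heq] at hq; exact hq.2 (by rwa [h.isOpen.interior_eq])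
  have hsub : ball y (dist y q) ⊆ Ω :=
    h.isOpen.subset_of_isPreconnected_of_disjoint_frontier (convex_ball _ _).isPreconnected
      ⟨y, mem_ball_self hr, hy⟩ (hqd ▸ disjoint_ball_infDist)
  refine h.fderiv_ne_zero_of_ball_subset hr hsub hq (by rw [← dist_eq_norm, dist_comm]) ?_
  refine IsLocalMin.fderiv_eq_zero ?_
  have hqp : dist q p < ρ := by
    have h1 := dist_triangle q y p
    rw [dist_comm q y] at h1
    rw [dist_comm p y] at hyp
    linarith
  filter_upwards [isOpen_interior.mem_nhds (hball hqp)] with z hz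
  rw [h.eq_zero q hq]
  exact h.nonneg (interior_subset hz)

theorem exists_inner_normal (h : IsPositiveSolution Ω V f u) (hc : Convex ℝ Ω)
    (hb : SmoothPosCurvBoundary Ω) {p : Plane} (hp : p ∈ frontier Ω) :
    ∃ n : Plane, n ≠ 0 ∧ ball (p + (2⁻¹ : ℝ) • n) (2⁻¹ * ‖n‖) ⊆ Ω := by
  obtain ⟨T, hT, γ, hγ, hper, hrange, hcurv⟩ := hb
  exact exists_interior_ball h.isOpen hc h.nonempty (contDiff_infty.1 hγ 2) hT hper
    hrange (fun t => (hcurv t).1) hp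

theorem fderiv_ne_zero (h : IsPositiveSolution Ω V f u) (hc : Convex ℝ Ω)
    (hb : SmoothPosCurvBoundary Ω) {p : Plane} (hp : p ∈ frontier Ω) : fderiv ℝ u p ≠ 0 := by
  obtain ⟨n, hn, hball⟩ := h.exists_inner_normal hc hb hp
  have := norm_pos_iff.2 hn
  exact h.fderiv_ne_zero_of_ball_subset (by positivity) hball hp (by simp [norm_smul])

theorem fderiv_pos_of_mem (h : IsPositiveSolution Ω V f u) (hc : Convex ℝ Ω)
    (hb : SmoothPosCurvBoundary Ω) {p : Plane} (hp : p ∈ frontier Ω) {y : Plane} (hy : y ∈ Ω) :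
    0 < fderiv ℝ u p (y - p) := by
  have hnn : ∀ z ∈ Ω, 0 ≤ fderiv ℝ u p (z - p) := fun z hz => by
    refine le_fderiv_of_eventually_le ((h.contDiffAt hp.1).differentiableAt (by norm_num))
      (h.eq_zero p hp) ?_
    filter_upwards [Ioc_mem_nhdsGT one_pos] with t ht
    rw [zero_mul]
    refine h.nonneg (interior_subset (s := closure Ω) ?_)
    rw [h.interior_closure]
    have := hc.add_smul_sub_mem_interior' hp.1 (by rwa [h.isOpen.interior_eq]) ht
    rwa [h.isOpen.interior_eq] at this
  obtain ⟨w, hw⟩ : ∃ w, 0 < fderiv ℝ u p w := by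
    by_contra! hle
    refine h.fderiv_ne_zero hc hb hp (ContinuousLinearMap.ext fun w => le_antisymm (hle w) ?_)
    have := hle (-w)
    rw [map_neg] at this
    simpa using this
  have hct : Tendsto (fun s : ℝ => y - s • w) (𝓝[>] 0) (𝓝 y) :=
    ((by fun_prop : Continuous fun s : ℝ => y - s • w).tendsto' 0 y (by simp)).mono_left
      nhdsWithin_le_nhds
  obtain ⟨s, hs, hs0⟩ := ((hct.eventually (h.isOpen.mem_nhds hy)).and self_mem_nhdsWithin).exists
  have h1 := hnn _ hs
  have h2 : y - s • w - p = (y - p) - s • w := by abel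
  rw [h2, map_sub, map_smul, smul_eq_mul] at h1
  have := mul_pos hs0 hw
  linarith

theorem exists_add_smul_mem (h : IsPositiveSolution Ω V f u) (hc : Convex ℝ Ω)
    (hb : SmoothPosCurvBoundary Ω) {p d : Plane} (hp : p ∈ frontier Ω)
    (hd : 0 < fderiv ℝ u p d) : ∃ t > (0:ℝ), p + t • d ∈ Ω := by
  obtain ⟨n, hn, hball⟩ := h.exists_inner_normal hc hb hp
  have key : ∀ w : Plane, 0 < inner ℝ n w → ∃ t > (0:ℝ), p + t • w ∈ Ω := fun w hw =>
    let ⟨t, ht, htm⟩ := exists_add_smul_mem_ball p hw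
    ⟨t, ht, hball htm⟩
  have key' : ∀ w : Plane, 0 < inner ℝ n w → 0 < fderiv ℝ u p w := fun w hw => by
    obtain ⟨t, ht, htm⟩ := key w hw
    have := h.fderiv_pos_of_mem hc hb hp htm
    rw [add_sub_cancel_left, map_smul, smul_eq_mul] at this
    exact pos_of_mul_pos_right this ht.le
  refine key d ?_
  have hnn : 0 < inner ℝ n n := real_inner_self_pos.2 hn
  by_contra! hle
  have hLn := key' n hnn
  have := key' (-d + (fderiv ℝ u p d / fderiv ℝ u p n) • n) (by
    rw [inner_add_right, inner_neg_right, inner_smul_right]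
    have : 0 < fderiv ℝ u p d / fderiv ℝ u p n * inner ℝ n n := by positivity
    linarith)
  rw [map_add, map_neg, map_smul, smul_eq_mul, div_mul_cancel₀ _ hLn.ne'] at this
  linarith

theorem fderiv_fderiv_ne_zero_of_mem_frontier (h : IsPositiveSolution Ω V f u)
    (hc : Convex ℝ Ω) (hb : SmoothPosCurvBoundary Ω) {p e : Plane} (hp : p ∈ frontier Ω)
    (he : ‖e‖ = 1) (hpe : fderiv ℝ u p e = 0) : fderiv ℝ (fderiv ℝ u) p e ≠ 0 := by
  have hL := h.fderiv_ne_zero hc hb hp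
  obtain ⟨T, hT, γ, hγ, hper, hrange, hcurv⟩ := hb
  obtain ⟨t₁, rfl⟩ : p ∈ range γ := hrange ▸ hp
  have hγ1 : ∀ t, HasDerivAt γ (deriv γ t) t := fun t =>
    (hγ.differentiable (by simp) t).hasDerivAt
  have hγ2 : HasDerivAt (deriv γ) (deriv (deriv γ) t₁) t₁ :=
    (((contDiff_infty_iff_deriv.1 hγ).2).differentiable (by simp) t₁).hasDerivAt
  have hmem : ∀ t, γ t ∈ frontier Ω := fun t => hrange ▸ mem_range_self t
  have hu0 : ∀ t, fderiv ℝ u (γ t) (deriv γ t) = 0 := fun t => by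
    have h1 := (((h.contDiffAt (hmem t).1).differentiableAt (by norm_num)).hasFDerivAt
      ).comp_hasDerivAt t (hγ1 t)
    have h2 : u ∘ γ = fun _ => 0 := funext fun s => h.eq_zero _ (hmem s)
    rw [h2] at h1
    exact h1.unique (hasDerivAt_const t (0:ℝ))
  intro h0
  have hd2 : DifferentiableAt ℝ (fderiv ℝ u) (γ t₁) :=
    ((h.contDiffAt (hmem t₁).1).fderiv_right (m := 1) (by norm_num)).differentiableAt (by norm_num)
  have h3 : HasDerivAt (fun t => fderiv ℝ u (γ t) (deriv γ t))
      (fderiv ℝ (fderiv ℝ u) (γ t₁) (deriv γ t₁) (deriv γ t₁)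
        + fderiv ℝ u (γ t₁) (deriv (deriv γ) t₁)) t₁ :=
    (hd2.hasFDerivAt.comp_hasDerivAt t₁ (hγ1 t₁)).clm_apply hγ2
  have h4 := h3.unique ((hasDerivAt_const t₁ (0:ℝ)).congr_of_eventuallyEq
    (Eventually.of_forall hu0))
  have hrot : fderiv ℝ u (γ t₁) (rot e) ≠ 0 := fun hr =>
    hL (clm_ext_frame he (by simpa using hpe) (by simpa using hr))
  have hker : ∀ w, fderiv ℝ u (γ t₁) w = 0 → w = inner ℝ e w • e := fun w hw => by
    have hw2 := hw
    rw [eq_inner_smul_add he w, map_add, map_smul, map_smul, hpe] at hw2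
    have : inner ℝ (rot e) w = 0 := by simpa [hrot] using hw2
    conv_lhs => rw [eq_inner_smul_add he w, this, zero_smul, add_zero]
  have hγ' := hker _ (hu0 t₁)
  have h5 : fderiv ℝ (fderiv ℝ u) (γ t₁) (deriv γ t₁) = 0 := by rw [hγ', map_smul, h0, smul_zero]
  rw [h5, zero_apply, zero_add] at h4
  have hγ'' := hker _ h4
  have hpos := (hcurv t₁).2
  rw [hγ', hγ''] at hpos
  simp only [PiLp.smul_apply, smul_eq_mul] at hpos
  exact lt_irrefl _ (hpos.trans_eq (by ring))

end IsPositiveSolution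
end InteriorBall

noncomputable section Linearized

open Topology Filter Plane

section Third

variable {E : Type*} [NormedAddCommGroup E] [NormedSpace ℝ E] {u : E → ℝ} {x : E}

theorem ContDiffAt.hasFDerivAt_fderiv_apply (hu : ContDiffAt ℝ 2 u x) (w : E) :
    HasFDerivAt (fun y => fderiv ℝ u y w) ((fderiv ℝ (fderiv ℝ u) x).flip w) x := by
  have := (((hu.fderiv_right (m := 1) (by norm_num)).differentiableAt
    (by norm_num)).hasFDerivAt).clm_apply (hasFDerivAt_const w x)
  simpa using this

theorem ContDiffAt.fderiv_fderiv_fderiv_apply (hu : ContDiffAt ℝ 3 u x) (z w w' : E) :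
    fderiv ℝ (fderiv ℝ fun y => fderiv ℝ u y w') x z w
      = fderiv ℝ (fun y => fderiv ℝ (fderiv ℝ u) y w w') x z := by
  have hev : ∀ᶠ y in 𝓝 x, ContDiffAt ℝ 3 u y := hu.eventually (by simp)
  have hG : ContDiffAt ℝ 2 (fun y => fderiv ℝ u y w') x :=
    (hu.fderiv_right (m := 2) (by norm_num)).clm_apply contDiffAt_const
  have h1 := (hG.hasFDerivAt_fderiv_apply w).fderiv
  have h2 : (fun y => fderiv ℝ (fun y => fderiv ℝ u y w') y w)
      =ᶠ[𝓝 x] fun y => fderiv ℝ (fderiv ℝ u) y w w' := by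
    filter_upwards [hev] with y hy
    rw [((hy.of_le (by norm_num)).hasFDerivAt_fderiv_apply w').fderiv]
    rfl
  rw [h2.fderiv_eq] at h1
  rw [h1]
  rfl

end Third

theorem ContDiffAt.fderiv_fderiv_fderiv_rotate {u : Plane → ℝ} {x : Plane}
    (hu : ContDiffAt ℝ 3 u x) (z w w' : Plane) :
    fderiv ℝ (fun y => fderiv ℝ (fderiv ℝ u) y w w') x z
      = fderiv ℝ (fderiv ℝ fun y => fderiv ℝ u y z) x w w' := by
  have hG : ContDiffAt ℝ 2 (fun y => fderiv ℝ u y w') x :=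
    (hu.fderiv_right (m := 2) (by norm_num)).clm_apply contDiffAt_const
  have hev : ∀ᶠ y in 𝓝 x, ContDiffAt ℝ 3 u y := hu.eventually (by simp)
  rw [← hu.fderiv_fderiv_fderiv_apply, hG.fderiv_fderiv_symm, hu.fderiv_fderiv_fderiv_apply,
    hu.fderiv_fderiv_fderiv_apply]
  have : (fun y => fderiv ℝ (fderiv ℝ u) y z w') =ᶠ[𝓝 x]
      fun y => fderiv ℝ (fderiv ℝ u) y w' z := by
    filter_upwards [hev] with y hy
    exact (hy.of_le (by norm_num)).fderiv_fderiv_symm _ _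
  rw [this.fderiv_eq]

theorem ContDiffAt.hasDerivAt_fderiv_fderiv_line {u : Plane → ℝ} {x : Plane}
    (hu : ContDiffAt ℝ 3 u x) (z w w' : Plane) :
    HasDerivAt (fun t : ℝ => fderiv ℝ (fderiv ℝ u) (x + t • z) w w')
      (fderiv ℝ (fderiv ℝ fun y => fderiv ℝ u y z) x w w') 0 := by
  rw [← hu.fderiv_fderiv_fderiv_rotate]
  have h1 : DifferentiableAt ℝ (fun y => fderiv ℝ (fderiv ℝ u) y w w') x :=
    (((((hu.fderiv_right (m := 2) (by norm_num)).fderiv_right (m := 1)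
      (by norm_num)).differentiableAt (by norm_num)).clm_apply
      (differentiableAt_const w)).clm_apply (differentiableAt_const w'))
  have h2 : HasDerivAt (fun t : ℝ => x + t • z) z 0 := by
    simpa using ((hasDerivAt_id (0:ℝ)).smul_const z).const_add x
  have h3 : HasFDerivAt (fun y => fderiv ℝ (fderiv ℝ u) y w w')
      (fderiv ℝ (fun y => fderiv ℝ (fderiv ℝ u) y w w') x) (x + (0:ℝ) • z) := by
    simpa using h1.hasFDerivAt
  exact h3.comp_hasDerivAt 0 h2

theorem ContDiffAt.hasDerivAt_fderiv_line {u : Plane → ℝ} {x : Plane}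
    (hu : ContDiffAt ℝ 2 u x) (z w : Plane) :
    HasDerivAt (fun t : ℝ => fderiv ℝ u (x + t • z) w)
      (fderiv ℝ (fun y => fderiv ℝ u y z) x w) 0 := by
  have h2 : HasDerivAt (fun t : ℝ => x + t • z) z 0 := by
    simpa using ((hasDerivAt_id (0:ℝ)).smul_const z).const_add x
  have h3 : HasFDerivAt (fun y => fderiv ℝ u y w) ((fderiv ℝ (fderiv ℝ u) x).flip w)
    (x + (0:ℝ) • z) := by simpa using hu.hasFDerivAt_fderiv_apply w
  have := h3.comp_hasDerivAt 0 h2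
  rw [(hu.hasFDerivAt_fderiv_apply z).fderiv]
  refine this.congr_deriv ?_
  exact hu.fderiv_fderiv_symm _ _

namespace IsPositiveSolution

variable {Ω V : Set Plane} {f : ℝ → ℝ} {u : Plane → ℝ}

theorem contDiffAt_of_mem (h : IsPositiveSolution Ω V f u) {x : Plane} (hx : x ∈ Ω)
    {n : WithTop ℕ∞} : ContDiffAt ℝ n u x :=
  (h.analytic x hx).contDiffAt

/-- The first of the two drift coefficients of the linearized equation in the frame
`(a, rot a)`. -/
def driftFst (f : ℝ → ℝ) (u : Plane → ℝ) (a x : Plane) : ℝ :=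
  -2 * fderiv ℝ u x (rot a) * fderiv ℝ (fderiv ℝ u) x a (rot a)
    + 2 * fderiv ℝ u x a * fderiv ℝ (fderiv ℝ u) x (rot a) (rot a)
    - 3 * √(1 + fderiv ℝ u x a ^ 2 + fderiv ℝ u x (rot a) ^ 2) * fderiv ℝ u x a * f (u x)

/-- The second of the two drift coefficients of the linearized equation in the frame
`(a, rot a)`. -/
def driftSnd (f : ℝ → ℝ) (u : Plane → ℝ) (a x : Plane) : ℝ :=
  2 * fderiv ℝ u x (rot a) * fderiv ℝ (fderiv ℝ u) x a a
    - 2 * fderiv ℝ u x a * fderiv ℝ (fderiv ℝ u) x a (rot a)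
    - 3 * √(1 + fderiv ℝ u x a ^ 2 + fderiv ℝ u x (rot a) ^ 2) * fderiv ℝ u x (rot a) * f (u x)

/-- The zeroth order coefficient of the linearized equation in the frame `(a, rot a)`. -/
def potential (f : ℝ → ℝ) (u : Plane → ℝ) (a x : Plane) : ℝ :=
  -(√(1 + fderiv ℝ u x a ^ 2 + fderiv ℝ u x (rot a) ^ 2) ^ 3 * deriv f (u x))

theorem linearized_eq (h : IsPositiveSolution Ω V f u) {x : Plane} (hx : x ∈ Ω) {a : Plane}
    (ha : ‖a‖ = 1) :
    (1 + fderiv ℝ u x (rot a) ^ 2) * fderiv ℝ (fderiv ℝ fun y => fderiv ℝ u y a) x a a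
      + (-2 * fderiv ℝ u x a * fderiv ℝ u x (rot a))
        * fderiv ℝ (fderiv ℝ fun y => fderiv ℝ u y a) x a (rot a)
      + (1 + fderiv ℝ u x a ^ 2)
        * fderiv ℝ (fderiv ℝ fun y => fderiv ℝ u y a) x (rot a) (rot a)
      + driftFst f u a x * fderiv ℝ (fun y => fderiv ℝ u y a) x a
      + driftSnd f u a x * fderiv ℝ (fun y => fderiv ℝ u y a) x (rot a)
      + potential f u a x * fderiv ℝ u x a = 0 := by
  have hu3 : ContDiffAt ℝ 3 u x := h.contDiffAt_of_mem hx
  have hu2 : ContDiffAt ℝ 2 u x := h.contDiffAt_of_mem hx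
  have hline : Continuous fun t : ℝ => x + t • a := by fun_prop
  have hline0 : x + (0:ℝ) • a = x := by simp
  have hev : ∀ᶠ t in 𝓝 (0:ℝ), x + t • a ∈ Ω :=
    (hline.tendsto' 0 x hline0).eventually (h.isOpen.mem_nhds hx)
  have hp := hu2.hasDerivAt_fderiv_line a a
  have hq := hu2.hasDerivAt_fderiv_line a (rot a)
  have haa := hu3.hasDerivAt_fderiv_fderiv_line a a a
  have hab := hu3.hasDerivAt_fderiv_fderiv_line a a (rot a)
  have hbb := hu3.hasDerivAt_fderiv_fderiv_line a (rot a) (rot a)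
  have hut : HasDerivAt (fun t : ℝ => u (x + t • a)) (fderiv ℝ u x a) 0 := by
    have h2 : HasDerivAt (fun t : ℝ => x + t • a) a 0 := by
      simpa using ((hasDerivAt_id (0:ℝ)).smul_const a).const_add x
    have h3 : HasFDerivAt u (fderiv ℝ u x) (x + (0:ℝ) • a) := by
      simpa using (hu2.differentiableAt (by norm_num)).hasFDerivAt
    exact h3.comp_hasDerivAt 0 h2
  have hft : HasDerivAt (fun t : ℝ => f (u (x + t • a))) (deriv f (u x) * fderiv ℝ u x a) 0 := by
    have h1 : HasDerivAt f (deriv f (u x)) (u (x + (0:ℝ) • a)) := by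
      simpa using (h.analytic_rhs (u x) (mem_univ _)).differentiableAt.hasDerivAt
    exact h1.comp 0 hut
  have hpos : 0 < 1 + fderiv ℝ u x a ^ 2 + fderiv ℝ u x (rot a) ^ 2 := by positivity
  have hW := ((((hp.fun_pow 2).const_add 1).add (hq.fun_pow 2)).sqrt
    (by simp only [hline0, Pi.add_apply]; exact hpos.ne')).fun_pow 3
  have hL := ((((hq.fun_pow 2).const_add 1).mul haa).add
    (((hp.const_mul (-2)).mul hq).mul hab)).add (((hp.fun_pow 2).const_add 1).mul hbb)
  have hR := hW.mul hft
  have heq := hL.unique (hR.congr_of_eventuallyEq (by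
    filter_upwards [hev] with t ht
    exact h.frame_eq ht ha))
  simp only [Pi.add_apply, Pi.mul_apply, hline0] at heq
  have hWne : √(1 + fderiv ℝ u x a ^ 2 + fderiv ℝ u x (rot a) ^ 2) ≠ 0 :=
    (Real.sqrt_pos.2 hpos).ne'
  simp only [driftFst, driftSnd, potential]
  field_simp at heq
  norm_num at heq
  generalize √(1 + fderiv ℝ u x a ^ 2 + fderiv ℝ u x (rot a) ^ 2) = W at *
  refine mul_left_cancel₀ (mul_ne_zero two_ne_zero hWne) ?_
  linear_combination heq

theorem potential_nonpos (h : IsPositiveSolution Ω V f u) (a x : Plane) :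
    potential f u a x ≤ 0 :=
  neg_nonpos.2 (mul_nonneg (by positivity) h.monotone_rhs.deriv_nonneg)

theorem continuousOn_fderiv_apply (h : IsPositiveSolution Ω V f u) (w : Plane) :
    ContinuousOn (fun x => fderiv ℝ u x w) (closure Ω) :=
  h.continuousOn_fderiv.clm_apply continuousOn_const

theorem continuousOn_fderiv_fderiv_apply (h : IsPositiveSolution Ω V f u) (w w' : Plane) :
    ContinuousOn (fun x => fderiv ℝ (fderiv ℝ u) x w w') (closure Ω) :=
  (h.continuousOn_fderiv_fderiv.clm_apply continuousOn_const).clm_apply continuousOn_const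

theorem continuousOn_sqrt (h : IsPositiveSolution Ω V f u) (a : Plane) :
    ContinuousOn (fun x => √(1 + fderiv ℝ u x a ^ 2 + fderiv ℝ u x (rot a) ^ 2)) (closure Ω) :=
  ((continuousOn_const.add ((h.continuousOn_fderiv_apply a).pow 2)).add
    ((h.continuousOn_fderiv_apply (rot a)).pow 2)).sqrt

theorem continuousOn_rhs (h : IsPositiveSolution Ω V f u) :
    ContinuousOn (fun x => f (u x)) (closure Ω) :=
  h.analytic_rhs.continuousOn.comp h.continuousOn (mapsTo_univ _ _)

theorem continuousOn_driftFst (h : IsPositiveSolution Ω V f u) (a : Plane) :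
    ContinuousOn (driftFst f u a) (closure Ω) :=
  (((continuousOn_const.mul (h.continuousOn_fderiv_apply _)).mul
    (h.continuousOn_fderiv_fderiv_apply _ _)).add
    ((continuousOn_const.mul (h.continuousOn_fderiv_apply _)).mul
    (h.continuousOn_fderiv_fderiv_apply _ _))).sub
    (((continuousOn_const.mul (h.continuousOn_sqrt a)).mul (h.continuousOn_fderiv_apply _)).mul
      h.continuousOn_rhs)

theorem continuousOn_driftSnd (h : IsPositiveSolution Ω V f u) (a : Plane) :
    ContinuousOn (driftSnd f u a) (closure Ω) :=
  (((continuousOn_const.mul (h.continuousOn_fderiv_apply _)).mul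
    (h.continuousOn_fderiv_fderiv_apply _ _)).sub
    ((continuousOn_const.mul (h.continuousOn_fderiv_apply _)).mul
    (h.continuousOn_fderiv_fderiv_apply _ _))).sub
    (((continuousOn_const.mul (h.continuousOn_sqrt a)).mul (h.continuousOn_fderiv_apply _)).mul
      h.continuousOn_rhs)

theorem continuousOn_potential (h : IsPositiveSolution Ω V f u) (a : Plane) :
    ContinuousOn (potential f u a) (closure Ω) := by
  have h1 := h.continuousOn_fderiv
  have h3 : ContinuousOn (fun x => deriv f (u x)) (closure Ω) :=
    h.analytic_rhs.deriv.continuousOn.comp h.continuousOn (mapsTo_univ _ _)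
  unfold potential
  fun_prop

end IsPositiveSolution
end Linearized

noncomputable section MaximumPrinciple

open Topology Filter Plane

namespace IsPositiveSolution

variable {Ω V : Set Plane} {f : ℝ → ℝ} {u : Plane → ℝ}

/-- The weak maximum principle for directional derivatives of a solution. -/
theorem eq_empty_of_fderiv_apply_pos (h : IsPositiveSolution Ω V f u) {a : Plane} (ha : ‖a‖ = 1)
    {A : Set Plane} (hA : IsOpen A) (hAΩ : A ⊆ Ω) (hpos : ∀ x ∈ A, 0 < fderiv ℝ u x a)
    (hfr : ∀ x ∈ frontier A, fderiv ℝ u x a ≤ 0) : A = ∅ := by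
  refine eq_empty_of_forall_notMem fun z hz => ?_
  obtain ⟨B, hB⟩ := h.isCompact_closure.bddAbove_image (h.continuousOn_driftFst a).neg
  replace hB : ∀ x ∈ Ω, -driftFst f u a x ≤ B := fun x hx => hB ⟨x, subset_closure hx, rfl⟩
  set α : ℝ := |B| + 1 with hα
  have hα0 : 0 < α := by positivity
  have hαB : B < α := (le_abs_self B).trans_lt (lt_add_one _)
  set g : Plane → ℝ := fun y => inner ℝ a y with hg
  have hgC : ContDiff ℝ 2 g := contDiff_const.inner ℝ contDiff_id
  have hg1 : fderiv ℝ g = fun _ => innerSL ℝ a := funext fun y => (innerSL ℝ a).fderiv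
  have hHC : Continuous fun y => Real.exp (α * g y) := by fun_prop
  obtain ⟨S, hS⟩ := h.isCompact_closure.bddAbove_image hHC.continuousOn
  replace hS : ∀ x ∈ closure Ω, Real.exp (α * g x) ≤ S := fun x hx => hS ⟨x, hx, rfl⟩
  set ψ : ℝ → ℝ := fun s => Real.exp (α * s) - S with hψ
  have hψ1 : ∀ s, HasDerivAt ψ (Real.exp (α * s) * α) s := fun s => by
    simpa [hψ] using ((hasDerivAt_id s).const_mul α).exp
  have hψ2 : ∀ s, HasDerivAt (fun s => Real.exp (α * s) * α) (Real.exp (α * s) * α * α) s :=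
    fun s => by simpa using (((hasDerivAt_id s).const_mul α).exp).mul_const α
  set w : Plane → ℝ := fun y => ψ (g y) with hw
  have hwC : ContDiff ℝ 2 w := ((contDiff_const.mul hgC).exp).sub contDiff_const
  have hw1 : ∀ x d, fderiv ℝ w x d = Real.exp (α * g x) * α * inner ℝ a d := fun x d => by
    rw [hw, fderiv_comp_real hψ1 hgC, hg1]; simp
  have hw2 : ∀ x d d', fderiv ℝ (fderiv ℝ w) x d d'
      = Real.exp (α * g x) * α * α * (inner ℝ a d * inner ℝ a d') := fun x d d' => by
    rw [hw, fderiv_fderiv_comp_real hψ1 hψ2 hgC, hg1]; simp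
  have hwle : ∀ x ∈ closure Ω, w x ≤ 0 := fun x hx => sub_nonpos.2 (hS x hx)
  set v : Plane → ℝ := fun y => fderiv ℝ u y a with hv
  have hvC : ∀ x ∈ Ω, ContDiffAt ℝ 2 v x := fun x hx =>
    ((h.contDiffAt_of_mem (n := 3) hx).fderiv_right (m := 2) (by norm_num)).clm_apply
      contDiffAt_const
  set ε : ℝ := v z / (2 * (1 - w z)) with hε
  have hwz := hwle z (subset_closure (hAΩ hz))
  have hvz : 0 < v z := hpos z hz
  have hε0 : 0 < ε := div_pos hvz (by linarith)
  have hcmp : ∀ x ∈ A, 0 ≤ -v x - ε * w x := by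
    refine nonneg_of_forall_exists_fderiv_fderiv_neg hA (h.isBounded.subset hAΩ)
      (((h.continuousOn_fderiv_apply a).mono (closure_mono hAΩ)).neg.sub
        (continuousOn_const.mul hwC.continuous.continuousOn))
      (fun x hx => ((((hvC x (hAΩ hx)).neg).sub
        (contDiffAt_const.mul hwC.contDiffAt)).contDiffWithinAt)) ?_ ?_
    · intro x hx
      have h1 := hfr x hx
      have h2 := hwle x (closure_mono hAΩ hx.1)
      have h3 := mul_nonpos_of_nonneg_of_nonpos hε0.le h2
      simp only [hv]
      linarith
    · intro x hx _ hcrit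
      have hxΩ := hAΩ hx
      have hvx := hvC x hxΩ
      have hnv : ContDiffAt ℝ 2 (fun y => -v y) x := hvx.neg
      have hn1 : (fderiv ℝ fun y => -v y) = fun y => -fderiv ℝ v y :=
        funext fun y => fderiv_fun_neg
      have hn2 : ∀ d d', fderiv ℝ (fderiv ℝ fun y => -v y) x d d'
          = -fderiv ℝ (fderiv ℝ v) x d d' := fun d d' => by
        rw [hn1, fderiv_fun_neg]; rfl
      have hcr : ∀ d, fderiv ℝ v x d = -(ε * (Real.exp (α * g x) * α * inner ℝ a d)) :=
        fun d => by
          have := congrArg (fun L : Plane →L[ℝ] ℝ => L d) hcrit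
          rw [fderiv_sub_const_mul (hnv.differentiableAt (by norm_num)) hwC, hn1] at this
          simp only [sub_apply, neg_apply, smul_apply, zero_apply, smul_eq_mul, hw1] at this
          linarith
      refine exists_apply_self_neg _ (a := a) (b := rot a) (p := fderiv ℝ u x a)
        (q := fderiv ℝ u x (rot a)) ?_ ?_
      · simp only [fderiv_fderiv_sub_const_mul hnv hwC]
        rw [hnv.fderiv_fderiv_symm, hwC.contDiffAt.fderiv_fderiv_symm]
      · have e1 := h.linearized_eq hxΩ ha
        rw [hcr, hcr] at e1
        have e2 := mul_nonpos_of_nonpos_of_nonneg (h.potential_nonpos a x) (hpos x hx).le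
        have e3 := hB x hxΩ
        have e4 := mul_pos (mul_pos hε0 (mul_pos (Real.exp_pos (α * g x)) hα0))
          (by linarith : 0 < α + driftFst f u a x)
        simp only [fderiv_fderiv_sub_const_mul hnv hwC, hn2, hw2, inner_self_rot,
          real_inner_self_eq_norm_sq, ha] at e1 ⊢
        have e5 : 0 ≤ fderiv ℝ u x (rot a) ^ 2 * (ε * (Real.exp (α * g x) * α * α)) := by
          positivity
        linarith
  have h1 := hcmp z hz
  have h2 : ε * (2 * (1 - w z)) = v z := div_mul_cancel₀ _ (by linarith)
  nlinarith

end IsPositiveSolution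
end MaximumPrinciple

noncomputable section Connectedness

open Topology Filter Plane

/-- The points of `Ω` lying on a line with direction `a` through a boundary point near which
`Ω` coincides with a subset of `A`. -/
def shadow (Ω : Set Plane) (a : Plane) (A : Set Plane) : Set Plane :=
  {y | y ∈ Ω ∧ ∃ p ∈ frontier Ω, (∃ ρ > (0:ℝ), ball p ρ ∩ Ω ⊆ A) ∧ ∃ t > (0:ℝ), y = p + t • a}

section Shadow

variable {Ω : Set Plane} {a : Plane}

theorem exists_sub_smul_mem_frontier (hΩ : IsOpen Ω) {y : Plane} {r s : ℝ} (hrs : r ≤ s)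
    (hr : y - r • a ∈ Ω) (hs : y - s • a ∉ Ω) : ∃ t ∈ Icc r s, y - t • a ∈ frontier Ω := by
  by_contra! hn
  have hpre : IsPreconnected ((fun t : ℝ => y - t • a) '' Icc r s) :=
    isPreconnected_Icc.image _ (by fun_prop)
  refine hs (hΩ.subset_of_isPreconnected_of_disjoint_frontier hpre
    ⟨_, mem_image_of_mem _ (left_mem_Icc.2 hrs), hr⟩ ?_
    (mem_image_of_mem _ (right_mem_Icc.2 hrs)))
  rw [Set.disjoint_left]
  rintro _ ⟨t, ht, rfl⟩
  exact hn t ht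

theorem Convex.add_smul_mem_of_lt (hc : Convex ℝ Ω) (hΩ : IsOpen Ω) {p : Plane} {s t : ℝ}
    (hp : p ∈ closure Ω) (hpt : p + t • a ∈ Ω) (hs : 0 < s) (hst : s ≤ t) : p + s • a ∈ Ω := by
  have ht : 0 < t := hs.trans_le hst
  have := hc.add_smul_sub_mem_interior' hp (by rwa [hΩ.interior_eq])
    (⟨div_pos hs ht, (div_le_one ht).2 hst⟩ : s / t ∈ Ioc (0:ℝ) 1)
  rwa [hΩ.interior_eq, add_sub_cancel_left, smul_smul, div_mul_cancel₀ _ ht.ne'] at this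

theorem exists_frontier_add_smul (hΩ : IsOpen Ω) (hb : Bornology.IsBounded Ω) (ha : ‖a‖ = 1)
    {y : Plane} (hy : y ∈ Ω) : ∃ p ∈ frontier Ω, ∃ t > (0:ℝ), y = p + t • a := by
  obtain ⟨R, hR, hsub⟩ := hb.subset_ball_lt 0 y
  obtain ⟨t, ht, hf⟩ := exists_sub_smul_mem_frontier (a := a) hΩ hR.le (by simpa using hy)
    (fun hm => by
      have := hsub hm
      rw [mem_ball_iff_norm] at this
      simp [norm_smul, ha, abs_of_pos hR] at this)
  refine ⟨_, hf, t, ht.1.lt_of_ne ?_, by simp⟩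
  rintro rfl
  rw [zero_smul, sub_zero] at hf
  exact hf.2 (by rwa [hΩ.interior_eq])

theorem eq_of_frontier_add_smul (hΩ : IsOpen Ω) (hc : Convex ℝ Ω) {p p' : Plane}
    (hp : p ∈ frontier Ω) (hp' : p' ∈ frontier Ω) {t t' : ℝ} (ht : 0 < t) (ht' : 0 < t')
    (hy : p + t • a ∈ Ω) (heq : p + t • a = p' + t' • a) : p = p' := by
  have key : ∀ {q q' : Plane} {s s' : ℝ}, q ∈ frontier Ω → q' ∈ frontier Ω → 0 < s → s < s' →
      q + s • a ∈ Ω → q + s • a = q' + s' • a → False := by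
    intro q q' s s' hq hq' hs hss hm he
    have h1 : q = q' + (s' - s) • a := by
      rw [sub_smul, ← add_sub_assoc, ← he, add_sub_cancel_right]
    refine hq.2 ?_
    rw [hΩ.interior_eq, h1]
    exact hc.add_smul_mem_of_lt hΩ hq'.1 (he ▸ hm) (by linarith) (by linarith)
  rcases lt_trichotomy t t' with hlt | rfl | hlt
  · exact (key hp hp' ht hlt hy heq).elim
  · exact add_right_cancel heq
  · exact (key hp' hp ht' hlt (heq ▸ hy) heq.symm).elim

theorem isOpen_shadow (hΩ : IsOpen Ω) (hc : Convex ℝ Ω) (ha : ‖a‖ = 1) (A : Set Plane) :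
    IsOpen (shadow Ω a A) := by
  rw [isOpen_iff_mem_nhds]
  rintro _ ⟨hyΩ, p, hp, ⟨ρ, hρ, hρA⟩, t, ht, rfl⟩
  set s : ℝ := min (t / 2) (ρ / 2) with hs
  have hs0 : 0 < s := by positivity
  have hst : s ≤ t / 2 := min_le_left _ _
  have hsρ : s ≤ ρ / 2 := min_le_right _ _
  have h1 : p + t • a - (t - s) • a ∈ Ω := by
    have : p + t • a - (t - s) • a = p + s • a := by module
    rw [this]
    exact hc.add_smul_mem_of_lt hΩ hp.1 hyΩ hs0 (by linarith)
  have h2 : p + t • a - (t + s) • a ∈ (closure Ω)ᶜ := fun hm => by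
    have h3 := hc.add_smul_mem_of_lt (a := a) (s := s) (t := t + s) hΩ hm
      (by rwa [sub_add_cancel]) hs0 (by linarith)
    have h4 : p + t • a - (t + s) • a + s • a = p := by module
    rw [h4] at h3
    exact hp.2 (by rwa [hΩ.interior_eq])
  have hc1 : ContinuousAt (fun y : Plane => y - (t - s) • a) (p + t • a) := by fun_prop
  have hc2 : ContinuousAt (fun y : Plane => y - (t + s) • a) (p + t • a) := by fun_prop
  filter_upwards [hΩ.mem_nhds hyΩ, hc1.eventually (hΩ.mem_nhds h1),
    hc2.eventually (isClosed_closure.isOpen_compl.mem_nhds h2),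
    Metric.ball_mem_nhds (p + t • a) (half_pos hρ)] with y hy hy1 hy2 hy3
  obtain ⟨r, hr, hrf⟩ := exists_sub_smul_mem_frontier hΩ (by linarith) hy1
    (fun hm => hy2 (subset_closure hm))
  refine ⟨hy, _, hrf, ?_, r, by linarith [hr.1], by simp⟩
  have hd : dist (y - r • a) p < ρ := by
    have e : y - r • a - p = (y - (p + t • a)) + (t - r) • a := by module
    rw [dist_eq_norm, e]
    refine (norm_add_le _ _).trans_lt ?_
    rw [mem_ball_iff_norm] at hy3
    rw [norm_smul, ha, mul_one, Real.norm_eq_abs]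
    have : |t - r| ≤ s := abs_le.2 ⟨by linarith [hr.2], by linarith [hr.1]⟩
    linarith
  refine ⟨ρ - dist (y - r • a) p, by linarith, fun z hz => hρA ⟨?_, hz.2⟩⟩
  exact ball_subset_ball' (by linarith) hz.1

theorem disjoint_shadow (hΩ : IsOpen Ω) (hc : Convex ℝ Ω) {A A' : Set Plane}
    (hd : Disjoint A A') : Disjoint (shadow Ω a A) (shadow Ω a A') := by
  rw [Set.disjoint_left]
  rintro _ ⟨hy, p, hp, ⟨ρ, hρ, hA⟩, t, ht, rfl⟩ ⟨-, p', hp', ⟨ρ', hρ', hA'⟩, t', ht', heq⟩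
  obtain rfl := eq_of_frontier_add_smul hΩ hc hp hp' ht ht' hy heq
  obtain ⟨z, hz, hzd⟩ := Metric.mem_closure_iff.1 hp.1 (min ρ ρ') (lt_min hρ hρ')
  rw [dist_comm] at hzd
  exact Set.disjoint_left.1 hd (hA ⟨hzd.trans_le (min_le_left _ _), hz⟩)
    (hA' ⟨hzd.trans_le (min_le_right _ _), hz⟩)

end Shadow

namespace IsPositiveSolution

variable {Ω V : Set Plane} {f : ℝ → ℝ} {u : Plane → ℝ} {a : Plane}

theorem isOpen_fderiv_pos (h : IsPositiveSolution Ω V f u) (a : Plane) :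
    IsOpen {x | x ∈ Ω ∧ 0 < fderiv ℝ u x a} :=
  ((h.continuousOn_fderiv_apply a).mono subset_closure).isOpen_inter_preimage h.isOpen isOpen_Ioi

theorem exists_ball_subset_or (h : IsPositiveSolution Ω V f u) (hc : Convex ℝ Ω)
    {A A' : Set Plane} (hA : IsOpen A) (hA' : IsOpen A') (hd : Disjoint A A')
    (hAA' : {x | x ∈ Ω ∧ 0 < fderiv ℝ u x a} ⊆ A ∪ A') {p : Plane} (hp : p ∈ frontier Ω)
    (hpa : 0 < fderiv ℝ u p a) :
    (∃ ρ > (0:ℝ), ball p ρ ∩ Ω ⊆ A) ∨ ∃ ρ > (0:ℝ), ball p ρ ∩ Ω ⊆ A' := by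
  have hcont : ContinuousAt (fun y => fderiv ℝ u y a) p :=
    (((h.contDiffAt hp.1).fderiv_right (m := 1) (by norm_num)).clm_apply
      contDiffAt_const).continuousAt
  obtain ⟨ρ, hρ, hball⟩ := Metric.eventually_nhds_iff_ball.1 (hcont.eventually (lt_mem_nhds hpa))
  exact (((convex_ball p ρ).inter hc).isPreconnected.subset_or_subset hA hA' hd
    (fun z hz => hAA' ⟨hz.2, hball z hz.1⟩)).imp (fun h => ⟨ρ, hρ, h⟩) fun h => ⟨ρ, hρ, h⟩

theorem nonempty_shadow (h : IsPositiveSolution Ω V f u) (hc : Convex ℝ Ω)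
    (hb : SmoothPosCurvBoundary Ω) (ha : ‖a‖ = 1) {A A' : Set Plane} (hA : IsOpen A)
    (hA' : IsOpen A') (hd : Disjoint A A') (hAA' : {x | x ∈ Ω ∧ 0 < fderiv ℝ u x a} = A ∪ A')
    (hne : A.Nonempty) : (shadow Ω a A).Nonempty := by
  have hAP : ∀ x ∈ A, x ∈ Ω ∧ 0 < fderiv ℝ u x a := fun x hx => hAA'.ge (Or.inl hx)
  obtain ⟨x, hx, hxa⟩ : ∃ x ∈ frontier A, 0 < fderiv ℝ u x a := by
    by_contra! hle
    exact hne.ne_empty (h.eq_empty_of_fderiv_apply_pos ha hA (fun x hx => (hAP x hx).1)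
      (fun x hx => (hAP x hx).2) hle)
  have hdisj : ∀ {B : Set Plane}, IsOpen B → Disjoint A B → x ∉ B := fun hB hAB hxB =>
    Set.disjoint_left.1 (hAB.closure_left hB) hx.1 hxB
  have hxΩ : x ∉ Ω := fun hxΩ => by
    rcases hAA'.le ⟨hxΩ, hxa⟩ with h1 | h1
    · exact hx.2 (by rwa [hA.interior_eq])
    · exact hdisj hA' hd h1
  have hxf : x ∈ frontier Ω :=
    h.mem_frontier (closure_mono (fun z hz => (hAP z hz).1) hx.1) hxΩ
  obtain ⟨t, ht, htm⟩ := h.exists_add_smul_mem hc hb hxf hxa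
  refine ⟨x + t • a, htm, x, hxf, ?_, t, ht, rfl⟩
  refine (h.exists_ball_subset_or hc hA hA' hd hAA'.le hxf hxa).resolve_right ?_
  rintro ⟨ρ, hρ, hball⟩
  refine hdisj isOpen_ball (Set.disjoint_left.2 fun z hz hzb => ?_) (mem_ball_self hρ)
  exact Set.disjoint_left.1 hd hz (hball ⟨hzb, (hAP z hz).1⟩)

theorem isPreconnected_fderiv_pos (h : IsPositiveSolution Ω V f u) (hc : Convex ℝ Ω)
    (hb : SmoothPosCurvBoundary Ω) (ha : ‖a‖ = 1) :
    IsPreconnected {x | x ∈ Ω ∧ 0 < fderiv ℝ u x a} := by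
  rw [isPreconnected_iff_subset_of_disjoint]
  intro B B' hB hB' hsub hdis
  by_contra! hn
  set P := {x | x ∈ Ω ∧ 0 < fderiv ℝ u x a} with hP
  have hPo : IsOpen P := h.isOpen_fderiv_pos a
  have hd : Disjoint (P ∩ B) (P ∩ B') := Set.disjoint_left.2 fun x hx hx' => by
    have : x ∈ P ∩ (B ∩ B') := ⟨hx.1, hx.2, hx'.2⟩
    rw [hdis] at this
    exact this
  have hun : P = P ∩ B ∪ P ∩ B' := by rw [← inter_union_distrib_left, inter_eq_left.2 hsub]
  obtain ⟨x, hx, hxB⟩ := not_subset.1 hn.1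
  obtain ⟨y, hy, hyB'⟩ := not_subset.1 hn.2
  have hA := hPo.inter hB
  have hA' := hPo.inter hB'
  have hne := h.nonempty_shadow hc hb ha hA hA' hd hun ⟨y, hy, (hsub hy).resolve_right hyB'⟩
  have hne' := h.nonempty_shadow hc hb ha hA' hA hd.symm (hun.trans (union_comm _ _))
    ⟨x, hx, (hsub hx).resolve_left hxB⟩
  have hds := disjoint_shadow (a := a) h.isOpen hc hd
  have hcover : Ω ⊆ shadow Ω a (P ∩ B) ∪ shadow Ω a (P ∩ B') := fun z hz => by
    obtain ⟨p, hp, t, ht, rfl⟩ := exists_frontier_add_smul h.isOpen h.isBounded ha hz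
    have hpa := h.fderiv_pos_of_mem hc hb hp hz
    rw [add_sub_cancel_left, map_smul, smul_eq_mul] at hpa
    exact (h.exists_ball_subset_or hc hA hA' hd hun.le hp (pos_of_mul_pos_right hpa ht.le)).imp
      (fun hρ => ⟨hz, p, hp, hρ, t, ht, rfl⟩) fun hρ => ⟨hz, p, hp, hρ, t, ht, rfl⟩
  obtain ⟨z, hz⟩ := hne
  obtain ⟨z', hz'⟩ := hne'
  have := hc.isPreconnected.subset_left_of_subset_union (isOpen_shadow h.isOpen hc ha _)
    (isOpen_shadow h.isOpen hc ha _) hds hcover ⟨z, hz.1, hz⟩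
  exact Set.disjoint_left.1 hds (this hz'.1) hz'

end IsPositiveSolution
end Connectedness

noncomputable section Interior

open Topology Filter Plane

theorem exists_Ioc_smul_mem {P : Set ℝ} (h : ∀ᶠ t in 𝓝[>] (0:ℝ), t ∈ P) :
    ∃ ε > (0:ℝ), ∀ t ∈ Ioc (0:ℝ) 1, t * ε ∈ P := by
  obtain ⟨ε, hε, hsub⟩ := mem_nhdsGT_iff_exists_Ioc_subset.1 h
  exact ⟨ε, hε, fun t ht => hsub ⟨mul_pos ht.1 hε, mul_le_of_le_one_left (le_of_lt hε) ht.2⟩⟩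

theorem exists_polar {s : ℝ} (hs : s ≠ 0) {a : Plane} (ha : ‖a‖ = 1) (y : Plane) :
    ∃ r θ : ℝ, y = r • (Real.cos θ • (s • a) + Real.sin θ • rot a) := by
  set z : ℂ := ⟨inner ℝ a y / s, inner ℝ (rot a) y⟩ with hz
  refine ⟨‖z‖, z.arg, ?_⟩
  have h1 : ‖z‖ * Real.cos z.arg = inner ℝ a y / s := Complex.norm_mul_cos_arg z
  have h2 : ‖z‖ * Real.sin z.arg = inner ℝ (rot a) y := Complex.norm_mul_sin_arg z
  rw [smul_add, smul_smul, smul_smul, smul_smul, h1, h2, div_mul_cancel₀ _ hs]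
  exact eq_inner_smul_add ha y

namespace IsPositiveSolution

variable {Ω V : Set Plane} {f : ℝ → ℝ} {u : Plane → ℝ} {a : Plane}

theorem analyticOnNhd_fderiv_apply (h : IsPositiveSolution Ω V f u) (a : Plane) :
    AnalyticOnNhd ℝ (fun y => fderiv ℝ u y a) Ω := fun x hx =>
  ((ContinuousLinearMap.apply ℝ ℝ a).analyticAt _).comp (h.analytic x hx).fderiv

theorem exists_frontier_fderiv_pos (h : IsPositiveSolution Ω V f u) (hc : Convex ℝ Ω)
    (hb : SmoothPosCurvBoundary Ω) (ha : ‖a‖ = 1) :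
    ∃ p ∈ frontier Ω, 0 < fderiv ℝ u p a := by
  obtain ⟨y, hy⟩ := h.nonempty
  obtain ⟨p, hp, t, ht, rfl⟩ := exists_frontier_add_smul h.isOpen h.isBounded ha hy
  have hpa := h.fderiv_pos_of_mem hc hb hp hy
  rw [add_sub_cancel_left, map_smul, smul_eq_mul] at hpa
  exact ⟨p, hp, pos_of_mul_pos_right hpa ht.le⟩

theorem not_eventually_fderiv_eq_zero (h : IsPositiveSolution Ω V f u) (hc : Convex ℝ Ω)
    (hb : SmoothPosCurvBoundary Ω) (ha : ‖a‖ = 1) {x : Plane} (hx : x ∈ Ω) :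
    ¬ ∀ᶠ y in 𝓝 x, fderiv ℝ u y a = 0 := fun hev => by
  have h0 : EqOn (fun y => fderiv ℝ u y a) 0 Ω :=
    (h.analyticOnNhd_fderiv_apply a).eqOn_zero_of_preconnected_of_eventuallyEq_zero
      hc.isPreconnected hx hev
  obtain ⟨p, hp, hpa⟩ := h.exists_frontier_fderiv_pos hc hb ha
  have h1 : EqOn (fun y => fderiv ℝ u y a) 0 (closure Ω) :=
    h0.of_subset_closure (h.continuousOn_fderiv_apply a) continuousOn_const subset_closure
      Subset.rfl
  exact hpa.ne' (h1 hp.1)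

/-- The affine coordinate chart of the plane with origin `x` and axes `a`, `rot a`. -/
def chart (x a : Plane) (z : ℂ) : Plane := x + (z.re • a + z.im • rot a)

theorem isPathConnected_chart_preimage {P : Set Plane} (hP : IsOpen P) (hpre : IsPreconnected P)
    (hne : P.Nonempty) (ha : ‖a‖ = 1) (x : Plane) : IsPathConnected (chart x a ⁻¹' P) := by
  have hpc : IsPathConnected P := (hP.isConnected_iff_isPathConnected).1 ⟨hne, hpre⟩
  set ψ : Plane → ℂ := fun y => ⟨inner ℝ a (y - x), inner ℝ (rot a) (y - x)⟩ with hψ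
  have hψc : Continuous ψ := by
    have : ψ = fun y => ((inner ℝ a (y - x) : ℝ) : ℂ)
        + ((inner ℝ (rot a) (y - x) : ℝ) : ℂ) * Complex.I :=
      funext fun y => by apply Complex.ext <;> simp [hψ]
    rw [this]
    fun_prop
  have h1 : ∀ y, chart x a (ψ y) = y := fun y => by
    simp only [chart, hψ]
    rw [← eq_inner_smul_add ha (y - x), add_sub_cancel]
  have h2 : ∀ z, ψ (chart x a z) = z := fun z => by
    apply Complex.ext <;>
      simp [chart, hψ, inner_add_right, inner_smul_right, inner_self_rot, inner_rot_self, norm_rot,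
        ha]
  have : chart x a ⁻¹' P = ψ '' P := by
    ext z
    exact ⟨fun hz => ⟨_, hz, h2 z⟩, fun ⟨y, hy, hyz⟩ => by
      rw [mem_preimage, ← hyz, h1]; exact hy⟩
  rw [this]
  exact hpc.image hψc

theorem fderiv_fderiv_ne_zero_of_mem (h : IsPositiveSolution Ω V f u) (hc : Convex ℝ Ω)
    (hb : SmoothPosCurvBoundary Ω) (ha : ‖a‖ = 1) {x : Plane} (hx : x ∈ Ω)
    (hxa : fderiv ℝ u x a = 0) : fderiv ℝ (fderiv ℝ u) x a ≠ 0 := by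
  intro h0
  have hu2 : ContDiffAt ℝ 2 u x := h.contDiffAt_of_mem hx
  have hv1 : fderiv ℝ (fun y => fderiv ℝ u y a) x = 0 := by
    rw [(hu2.hasFDerivAt_fderiv_apply a).fderiv]
    ext w
    rw [ContinuousLinearMap.flip_apply, hu2.fderiv_fderiv_symm, h0]
  have hnhd : closure Ω ∈ 𝓝 x := Filter.mem_of_superset (h.isOpen.mem_nhds hx) subset_closure
  have hp := (h.continuousOn_fderiv_apply a).continuousAt hnhd
  have hq := (h.continuousOn_fderiv_apply (rot a)).continuousAt hnhd
  set q : ℝ := fderiv ℝ u x (rot a) with hqdef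
  set s : ℝ := √(1 + q ^ 2) with hs
  have hs2 : s * s = 1 + q ^ 2 := Real.mul_self_sqrt (by positivity)
  have hs0 : 0 < s := Real.sqrt_pos.2 (by positivity)
  obtain ⟨θ₁, θ₂, θ₃, θ₄, s12, s23, s34, s41, r1, r2, r3, r4⟩ :=
    exists_alternating_rays (v := fun y => fderiv ℝ u y a) (a₁ := a) (a₂ := rot a)
      (m₁ := s • a) (m₂ := rot a)
      (h.analyticOnNhd_fderiv_apply a x hx) hxa hv1
      (h.not_eventually_fderiv_eq_zero hc hb ha hx)
      (continuousAt_const.add (hq.pow 2)) ((continuousAt_const.mul hp).mul hq)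
      (continuousAt_const.add (hp.pow 2)) ((h.continuousOn_driftFst a).continuousAt hnhd)
      ((h.continuousOn_driftSnd a).continuousAt hnhd)
      ((h.continuousOn_potential a).continuousAt hnhd)
      (by
        filter_upwards [h.isOpen.mem_nhds hx] with y hy
        exact h.linearized_eq hy ha)
      (fun D => by
        simp only [hxa, map_smul, smul_apply, smul_eq_mul, Pi.add_apply, Pi.mul_apply,
          Pi.pow_apply, ← hqdef]
        linear_combination (-D a a) * hs2)
      (exists_polar hs0.ne' ha)
  have hin : ∀ w : Plane, ∀ᶠ t in 𝓝[>] (0:ℝ), x + t • w ∈ Ω := fun w =>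
    (((by fun_prop : Continuous fun t : ℝ => x + t • w).tendsto' 0 x (by simp)).eventually
      (h.isOpen.mem_nhds hx)).filter_mono nhdsWithin_le_nhds
  set P : Set Plane := {y | y ∈ Ω ∧ 0 < fderiv ℝ u y a} with hP
  set N : Set Plane := {y | y ∈ Ω ∧ 0 < fderiv ℝ u y (-a)} with hN
  set e : ℝ → ℂ := fun θ => ⟨s * Real.cos θ, Real.sin θ⟩ with he
  have hchart : ∀ ε t θ : ℝ, chart x a ((t : ℂ) * (ε * e θ))
      = x + (t * ε) • (Real.cos θ • s • a + Real.sin θ • rot a) := fun ε t θ => by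
    simp only [chart, he]
    congr 1
    simp
    module
  have key : ∀ {B : Set Plane} {θ : ℝ},
      (∀ᶠ t in 𝓝[>] (0:ℝ), x + t • (Real.cos θ • s • a + Real.sin θ • rot a) ∈ B) →
      ∃ ε > (0:ℝ), ∀ t ∈ Ioc (0:ℝ) 1, (t : ℂ) * (ε * e θ) ∈ chart x a ⁻¹' B := fun hB => by
    obtain ⟨ε, hε, hm⟩ := exists_Ioc_smul_mem hB
    exact ⟨ε, hε, fun t ht => by rw [mem_preimage, hchart]; exact hm t ht⟩
  obtain ⟨ε₁, hε₁, k1⟩ := key (B := P) ((hin _).and r1)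
  obtain ⟨ε₂, hε₂, k2⟩ := key (B := N) ((hin _).and (r2.mono fun t ht => by
    rw [map_neg]; exact neg_pos.2 ht))
  obtain ⟨ε₃, hε₃, k3⟩ := key (B := P) ((hin _).and r3)
  obtain ⟨ε₄, hε₄, k4⟩ := key (B := N) ((hin _).and (r4.mono fun t ht => by
    rw [map_neg]; exact neg_pos.2 ht))
  have one_mem : (1:ℝ) ∈ Ioc (0:ℝ) 1 := ⟨one_pos, le_rfl⟩
  have m1 := k1 1 one_mem
  have m2 := k2 1 one_mem
  have m3 := k3 1 one_mem
  have m4 := k4 1 one_mem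
  simp only [Complex.ofReal_one, one_mul] at m1 m2 m3 m4
  have hPc : IsPathConnected (chart x a ⁻¹' P) := isPathConnected_chart_preimage
    (h.isOpen_fderiv_pos a) (h.isPreconnected_fderiv_pos hc hb ha) ⟨_, m1⟩ ha x
  have hNc : IsPathConnected (chart x a ⁻¹' N) := isPathConnected_chart_preimage
    (h.isOpen_fderiv_pos (-a)) (h.isPreconnected_fderiv_pos hc hb (by rwa [norm_neg])) ⟨_, m2⟩ ha x
  have hdisj : Disjoint P N := Set.disjoint_left.2 fun y hy hy' => by
    have := hy'.2
    rw [map_neg] at this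
    linarith [hy.2]
  have hx0 : chart x a 0 = x := by simp [chart]
  have him : ∀ {ε ε' θ θ' : ℝ}, 0 < ε → 0 < ε' → 0 < Real.sin (θ' - θ) →
      0 < (starRingEnd ℂ (ε * e θ) * (ε' * e θ')).im := fun {ε ε' θ θ'} hε hε' hsin => by
    have : (starRingEnd ℂ (ε * e θ) * (ε' * e θ')).im = ε * ε' * s * Real.sin (θ' - θ) := by
      rw [Real.sin_sub]
      simp [he]
      ring
    rw [this]
    positivity
  refine false_of_joined_alternating (hdisj.preimage (chart x a)) ?_ ?_ k1 k2 k3 k4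
    (hPc.joinedIn _ m1 _ m3) (hNc.joinedIn _ m2 _ m4) (him hε₁ hε₂ s12) (him hε₂ hε₃ s23)
    (him hε₃ hε₄ s34) (him hε₄ hε₁ s41)
  · rw [mem_preimage, hx0]
    exact fun hm => hm.2.ne' hxa
  · rw [mem_preimage, hx0]
    exact fun hm => hm.2.ne' (by rw [map_neg, hxa, neg_zero])

end IsPositiveSolution
end Interior

section LowerBound

open Topology Filter Plane

theorem Plane.gradient_eq_zero_iff {u : Plane → ℝ} {x : Plane} :
    gradient u x = 0 ↔ fderiv ℝ u x = 0 := by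
  simp [gradient]

theorem Plane.fderiv_rot_gradient (u : Plane → ℝ) (x : Plane) :
    fderiv ℝ u x (rot (gradient u x)) = 0 := by
  have : fderiv ℝ u x (rot (gradient u x)) = inner ℝ (gradient u x) (rot (gradient u x)) := by
    rw [gradient, InnerProductSpace.toDual_symm_apply]
  rw [this, inner_self_rot]

theorem Xfield_eq {u : Plane → ℝ} {x : Plane} (hu : ContDiffAt ℝ 2 u x) :
    Xfield u x = (‖gradient u x‖ ^ 2)⁻¹ •
      (InnerProductSpace.toDual ℝ Plane).symm
        (fderiv ℝ (fderiv ℝ u) x (rot (gradient u x))) := by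
  rw [Xfield]
  congr 1
  refine ext_inner_right ℝ fun w => ?_
  rw [InnerProductSpace.toDual_symm_apply, inner_eq, hu.fderiv_fderiv_symm]
  conv_rhs => rw [rot_eq_coord, eq_coord w]
  simp [hessMatrix, hessEntry_eq_fderiv, Matrix.vecHead, Matrix.vecTail]
  ring

theorem norm_Xfield {u : Plane → ℝ} {x : Plane} (hu : ContDiffAt ℝ 2 u x) :
    ‖Xfield u x‖ = (‖gradient u x‖ ^ 2)⁻¹ *
      ‖fderiv ℝ (fderiv ℝ u) x (rot (gradient u x))‖ := by
  rw [Xfield_eq hu, norm_smul, LinearIsometryEquiv.norm_map, Real.norm_of_nonneg (by positivity)]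

namespace IsPositiveSolution

variable {Ω V : Set Plane} {f : ℝ → ℝ} {u : Plane → ℝ}

/-- The Hessian is uniformly nondegenerate on unit vectors tangent to the level sets. -/
theorem exists_forall_le_norm_fderiv_fderiv (h : IsPositiveSolution Ω V f u) (hc : Convex ℝ Ω)
    (hb : SmoothPosCurvBoundary Ω) : ∃ C > (0:ℝ), ∀ x ∈ closure Ω, ∀ e : Plane, ‖e‖ = 1 →
      fderiv ℝ u x e = 0 → C ≤ ‖fderiv ℝ (fderiv ℝ u) x e‖ := by
  set S : Set (Plane × Plane) := closure Ω ×ˢ sphere 0 1 with hS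
  have hSc : IsCompact S := h.isCompact_closure.prod (isCompact_sphere _ _)
  have hc1 : ContinuousOn (fun z : Plane × Plane => fderiv ℝ u z.1 z.2) S :=
    (h.continuousOn_fderiv.comp continuousOn_fst fun z hz => hz.1).clm_apply continuousOn_snd
  have hc2 : ContinuousOn (fun z : Plane × Plane => ‖fderiv ℝ (fderiv ℝ u) z.1 z.2‖) S :=
    ((h.continuousOn_fderiv_fderiv.comp continuousOn_fst fun z hz => hz.1).clm_apply
      continuousOn_snd).norm
  set Z : Set (Plane × Plane) := S ∩ (fun z : Plane × Plane => fderiv ℝ u z.1 z.2) ⁻¹' {0} with hZ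
  have hZc : IsCompact Z := hSc.of_isClosed_subset
    (hc1.preimage_isClosed_of_isClosed hSc.isClosed isClosed_singleton) inter_subset_left
  obtain ⟨C, hC, hle⟩ := hZc.exists_forall_le' (hc2.mono inter_subset_left) (a := 0)
    (fun z hz => norm_pos_iff.2 (by
      obtain ⟨⟨hz1, hz2⟩, hz3⟩ := hz
      rw [mem_sphere_zero_iff_norm] at hz2
      by_cases hzΩ : z.1 ∈ Ω
      · exact h.fderiv_fderiv_ne_zero_of_mem hc hb hz2 hzΩ hz3
      · exact h.fderiv_fderiv_ne_zero_of_mem_frontier hc hb (h.mem_frontier hz1 hzΩ) hz2 hz3))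
  exact ⟨C, hC, fun x hx e he hxe =>
    hle (x, e) ⟨⟨hx, mem_sphere_zero_iff_norm.2 he⟩, hxe⟩⟩

end IsPositiveSolution

end LowerBound

/-- The vector field `X` satisfies `|X| ≥ C/|∇u|` on `closure Ω \ K`; in
particular it is nonvanishing there. Here "C² up to the closure" is expressed by `u` being
`C²` on an open neighborhood of `closure Ω`. -/
theorem Xfield_lower_bound
    (Ω : Set (EuclideanSpace ℝ (Fin 2)))
    (hΩne : Ω.Nonempty) (hΩopen : IsOpen Ω) (hΩbd : Bornology.IsBounded Ω)
    (hΩconv : StrictConvex ℝ (closure Ω)) (hΩsmooth : SmoothPosCurvBoundary Ω)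
    (f : ℝ → ℝ) (hf : AnalyticOnNhd ℝ f Set.univ) (hfmono : Monotone f)
    (u : EuclideanSpace ℝ (Fin 2) → ℝ)
    (hsol : IsMCSolution Ω f u) (hupos : ∀ x ∈ Ω, 0 < u x)
    (huan : AnalyticOnNhd ℝ u Ω)
    (V : Set (EuclideanSpace ℝ (Fin 2))) (hVopen : IsOpen V) (hΩV : closure Ω ⊆ V)
    (huC2 : ContDiffOn ℝ 2 u V)
    (K : Set (EuclideanSpace ℝ (Fin 2))) (hK : K = {x | x ∈ Ω ∧ gradient u x = 0}) :
    (∃ C > (0:ℝ), ∀ x ∈ closure Ω \ K, C / ‖gradient u x‖ ≤ ‖Xfield u x‖) ∧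
      ∀ x ∈ closure Ω \ K, Xfield u x ≠ 0 := by
  subst hK
  have h : IsPositiveSolution Ω V f u :=
    ⟨hΩne, hΩopen, hΩbd, hf, hfmono, hsol.2.2.1, hsol.2.2.2, hupos, huan, hVopen, hΩV, huC2⟩
  have hc : Convex ℝ Ω := h.interior_closure ▸ hΩconv.convex.interior
  obtain ⟨C, hC, hle⟩ := h.exists_forall_le_norm_fderiv_fderiv hc hΩsmooth
  have hgrad : ∀ x ∈ closure Ω \ {x | x ∈ Ω ∧ gradient u x = 0}, 0 < ‖gradient u x‖ := by
    rintro x ⟨hx, hxK⟩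
    refine norm_pos_iff.2 fun h0 => ?_
    by_cases hxΩ : x ∈ Ω
    · exact hxK ⟨hxΩ, h0⟩
    · exact h.fderiv_ne_zero hc hΩsmooth (h.mem_frontier hx hxΩ) (Plane.gradient_eq_zero_iff.1 h0)
  have key : ∀ x ∈ closure Ω \ {x | x ∈ Ω ∧ gradient u x = 0},
      C / ‖gradient u x‖ ≤ ‖Xfield u x‖ := by
    intro x hx
    have hg := hgrad x hx
    have h1 := hle x hx.1 (‖gradient u x‖⁻¹ • Plane.rot (gradient u x))
      (by rw [norm_smul, norm_inv, norm_norm, Plane.norm_rot, inv_mul_cancel₀ hg.ne'])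
      (by rw [map_smul, Plane.fderiv_rot_gradient, smul_zero])
    rw [map_smul, norm_smul, norm_inv, norm_norm] at h1
    rw [norm_Xfield (h.contDiffAt hx.1), div_eq_inv_mul, sq, mul_inv, mul_assoc]
    gcongr
  refine ⟨⟨C, hC, key⟩, fun x hx h0 => ?_⟩
  have h1 := key x hx
  rw [h0, norm_zero] at h1
  exact (div_pos hC (hgrad x hx)).not_ge h1
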